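/- Let M be a subset of ℂⁿ. Then the set of points of M of finite type, {p ∈ M : Δ(M, p) < ∞}, is an open subset of M (in the subspace topology). -/

import Mathlib

open scoped ENNReal Topology

/-- Order of vanishing at `0` of a function `f` between real normed spaces:
the least `m` such that the `m`-th iterated (real) Fréchet derivative of `f` at `0`
is nonzero, and `∞` if all iterated derivatives vanish. -/
noncomputable def vOrder {E F : Type*} [NormedAddCommGroup E] [NormedSpace ℝ E]
    [NormedAddCommGroup F] [NormedSpace ℝ F] (f : E → F) : ℝ≥0∞ :=
  ⨅ m ∈ {m : ℕ | iteratedFDeriv ℝ m f 0 ≠ 0}, (m : ℝ≥0∞)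

/-- `ν(γ)` for a curve `γ : ℂ → ℂⁿ` through `p`: the minimum over the components of
the order of vanishing of `γ i - p i` at `0`. -/
noncomputable def nuCurve {n : ℕ} (γ : ℂ → Fin n → ℂ) (p : Fin n → ℂ) : ℝ≥0∞ :=
  ⨅ i : Fin n, vOrder (fun t => γ t i - p i)

/-- The set `𝒞` of (representatives of) nonconstant germs at `0 ∈ ℂ` of holomorphic
curves `γ` with `γ 0 = p`. -/
def Curves (n : ℕ) (p : Fin n → ℂ) : Set (ℂ → Fin n → ℂ) :=
  {γ | AnalyticAt ℂ γ 0 ∧ γ 0 = p ∧ ¬ (∀ᶠ t in 𝓝 (0 : ℂ), γ t = p)}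

/-- The set `I_M(p)` of (representatives of) germs at `p` of real-valued `C^∞` functions
defined in a neighborhood of `p` and vanishing on `M` near `p`. -/
def IMp (n : ℕ) (M : Set (Fin n → ℂ)) (p : Fin n → ℂ) : Set ((Fin n → ℂ) → ℝ) :=
  {r | ∃ U : Set (Fin n → ℂ), IsOpen U ∧ p ∈ U ∧ ContDiffOn ℝ (⊤ : ℕ∞) r U ∧
    ∀ z ∈ M ∩ U, r z = 0}

/-- The D'Angelo type `Δ(M,p)` of an arbitrary set `M ⊆ ℂⁿ` at `p`:
`Δ(M,p) = sup_{γ ∈ 𝒞} inf_{r ∈ I_M(p)} ν(r∘γ)/ν(γ)`. -/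
noncomputable def Delta (n : ℕ) (M : Set (Fin n → ℂ)) (p : Fin n → ℂ) : ℝ≥0∞ :=
  ⨆ γ ∈ Curves n p, ⨅ r ∈ IMp n M p,
    vOrder (fun t => r (γ t) - r p) / nuCurve γ p

/-- The Taylor polynomial `r_k` of order `k` of `r` at `p`. -/
noncomputable def taylorPoly (n k : ℕ) (r : (Fin n → ℂ) → ℝ) (p : Fin n → ℂ) :
    (Fin n → ℂ) → ℝ :=
  fun z => ∑ j ∈ Finset.range (k + 1),
    ((j.factorial : ℝ))⁻¹ • iteratedFDeriv ℝ j r p (fun _ => z - p)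

/-- `Δ(M_k,p) = sup_{γ ∈ 𝒞} inf_{r ∈ I_M(p)} ν(r_k∘γ)/ν(γ)`. -/
noncomputable def DeltaK (n : ℕ) (M : Set (Fin n → ℂ)) (p : Fin n → ℂ) (k : ℕ) : ℝ≥0∞ :=
  ⨆ γ ∈ Curves n p, ⨅ r ∈ IMp n M p,
    vOrder (fun t => taylorPoly n k r p (γ t) - taylorPoly n k r p p) / nuCurve γ p

open scoped PowerSeries in
theorem exists_dedekind_extension (A : Type) [CommRing A] [IsDomain A] [Algebra ℂ⟦X⟧ A]
    [Module.Finite ℂ⟦X⟧ A] (hinj : Function.Injective (algebraMap ℂ⟦X⟧ A)) :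
    ∃ (B : Type) (_ : CommRing B) (_ : IsDedekindDomain B) (φ : A →+* B) (Q : Ideal B),
      Function.Injective φ ∧ Q.IsPrime ∧ Q ≠ ⊥ ∧ φ (algebraMap ℂ⟦X⟧ A PowerSeries.X) ∈ Q ∧
      ∀ b : B, ∃ c : ℂ, b - φ (algebraMap ℂ⟦X⟧ A (PowerSeries.C c)) ∈ Q := by
  let K := FractionRing ℂ⟦X⟧
  let L := FractionRing A
  have : FaithfulSMul ℂ⟦X⟧ A := (faithfulSMul_iff_algebraMap_injective _ A).2 hinj
  have : FaithfulSMul ℂ⟦X⟧ L := FaithfulSMul.trans _ A L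
  let : Algebra K L := FractionRing.liftAlgebra _ L
  have : IsScalarTower ℂ⟦X⟧ K L := FractionRing.isScalarTower_liftAlgebra _ L
  have : FiniteDimensional K L := .of_isLocalization ℂ⟦X⟧ A (nonZeroDivisors ℂ⟦X⟧)
  have : CharZero K := algebraRat.charZero K
  have : IsDedekindDomain (integralClosure ℂ⟦X⟧ L) :=
    integralClosure.isDedekindDomain ℂ⟦X⟧ K L
  let B := integralClosure ℂ⟦X⟧ L
  let φ : A →ₐ[ℂ⟦X⟧] B := (IsScalarTower.toAlgHom ℂ⟦X⟧ A L).codRestrict B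
    fun a => (Algebra.IsIntegral.isIntegral (R := ℂ⟦X⟧) a).map (IsScalarTower.toAlgHom ℂ⟦X⟧ A L)
  have hφ : Function.Injective φ := fun a b h =>
    IsFractionRing.injective A L (congrArg Subtype.val h)
  have hψ : Function.Injective (algebraMap ℂ⟦X⟧ B) := by
    rw [← φ.comp_algebraMap]; exact hφ.comp hinj
  have : FaithfulSMul ℂ⟦X⟧ B := (faithfulSMul_iff_algebraMap_injective _ B).2 hψ
  obtain ⟨Q, hQ, hQX⟩ := Ideal.exists_maximal_ideal_liesOver_of_isIntegral (S := B)
    (IsLocalRing.maximalIdeal ℂ⟦X⟧)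
  have hX : algebraMap ℂ⟦X⟧ B PowerSeries.X ∈ Q := by
    rw [← Ideal.mem_of_liesOver Q (IsLocalRing.maximalIdeal ℂ⟦X⟧),
      PowerSeries.maximalIdeal_eq_span_X]
    exact Ideal.mem_span_singleton_self _
  refine ⟨B, inferInstance, ‹_›, φ, Q, hφ, hQ.isPrime, ?_, ?_, ?_⟩
  · rintro rfl
    rw [Ideal.mem_bot, map_eq_zero_iff _ hψ] at hX
    exact PowerSeries.X_ne_zero hX
  · simpa using hX
  · let π := Ideal.Quotient.mk Q
    let σ : ℂ →+* B ⧸ Q := (π.comp (algebraMap ℂ⟦X⟧ B)).comp PowerSeries.C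
    have h1 : σ.comp PowerSeries.constantCoeff = π.comp (algebraMap ℂ⟦X⟧ B) := by
      ext f
      change π _ = π _
      rw [Ideal.Quotient.eq, ← map_sub]
      obtain ⟨g, hg⟩ := PowerSeries.X_dvd_iff (φ := PowerSeries.C (PowerSeries.constantCoeff f) - f)
        |>.2 (by simp)
      rw [hg, map_mul]
      exact Q.mul_mem_right _ hX
    have h2 : (σ.comp PowerSeries.constantCoeff).IsIntegral := by
      rw [h1]
      exact RingHom.IsIntegral.trans _ _ (algebraMap_isIntegral_iff.2 inferInstance)
        (RingHom.isIntegral_of_surjective _ Ideal.Quotient.mk_surjective)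
    have h3 := IsAlgClosed.ringHom_bijective_of_isIntegral σ (h2.tower_top _ _)
    intro b
    obtain ⟨c, hc⟩ := h3.2 (π b)
    refine ⟨c, ?_⟩
    rw [← Ideal.Quotient.eq]
    change π b = π (φ (algebraMap ℂ⟦X⟧ A (PowerSeries.C c)))
    rw [AlgHom.commutes]
    exact hc.symm

theorem MvPowerSeries.mem_span_X_pow {σ k : Type*} [Fintype σ] [Field k] (N : ℕ)
    (f : MvPowerSeries σ k) (hf : ∀ α, α.degree < N → f.coeff α = 0) :
    f ∈ Ideal.span (Set.range (MvPowerSeries.X (σ := σ) (R := k))) ^ N := by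
  classical
  induction N generalizing f with
  | zero => simp
  | succ N ih =>
    have hex : ∀ α : σ →₀ ℕ, ∃ i : Option σ, α ≠ 0 → ∃ j, i = some j ∧ α j ≠ 0 := by
      intro α
      by_cases h : α = 0
      · exact ⟨none, fun h' => (h' h).elim⟩
      · obtain ⟨j, hj⟩ := Finsupp.ne_iff.1 h
        exact ⟨some j, fun _ => ⟨j, rfl, hj⟩⟩
    choose ι hι using hex
    let g : σ → MvPowerSeries σ k := fun i β =>
      if ι (β + .single i 1) = some i then f.coeff (β + .single i 1) else 0
    have hg : f = ∑ i, MvPowerSeries.monomial (.single i 1) (1 : k) * g i := by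
      ext α
      rw [map_sum]
      simp only [MvPowerSeries.coeff_monomial_mul, one_mul]
      by_cases h : α = 0
      · subst h
        rw [hf 0 (by simp)]
        refine (Finset.sum_eq_zero fun i _ => ?_).symm
        rw [if_neg]
        intro h
        simpa using h i
      · obtain ⟨j, hj, hj'⟩ := hι α h
        rw [Finset.sum_eq_single j]
        · have h1 : Finsupp.single j 1 ≤ α := by
            rw [Finsupp.single_le_iff]; lia
          rw [if_pos h1]
          change _ = if ι (α - .single j 1 + .single j 1) = some j then _ else _
          rw [tsub_add_cancel_of_le h1, if_pos hj]
        · intro i _ hij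
          split_ifs with h1
          · change (if ι (α - .single i 1 + .single i 1) = some i then _ else _) = _
            rw [tsub_add_cancel_of_le h1, hj, if_neg (by simpa using hij.symm)]
          · rfl
        · simp
    rw [hg]
    refine Ideal.sum_mem _ fun i _ => ?_
    rw [pow_succ']
    refine Ideal.mul_mem_mul ?_ (ih _ fun α hα => ?_)
    · exact Ideal.subset_span ⟨i, rfl⟩
    · change (if _ then _ else _) = _
      rw [hf _ (by simpa using hα)]
      simp

theorem MvPowerSeries.mem_maximalIdeal_iff {σ k : Type*} [Field k] {f : MvPowerSeries σ k} :
    f ∈ IsLocalRing.maximalIdeal (MvPowerSeries σ k) ↔ MvPowerSeries.constantCoeff f = 0 := by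
  rw [IsLocalRing.mem_maximalIdeal, mem_nonunits_iff, MvPowerSeries.isUnit_iff_constantCoeff]
  simp

theorem MvPowerSeries.maximalIdeal_eq_span_X {σ k : Type*} [Fintype σ] [Field k] :
    IsLocalRing.maximalIdeal (MvPowerSeries σ k) = Ideal.span (Set.range MvPowerSeries.X) := by
  refine le_antisymm (fun f hf => ?_) ?_
  · rw [MvPowerSeries.mem_maximalIdeal_iff] at hf
    rw [← pow_one (Ideal.span _)]
    refine MvPowerSeries.mem_span_X_pow 1 f fun α hα => ?_
    obtain rfl : α = 0 := (Finsupp.degree_eq_zero_iff α).1 (by lia)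
    simpa using hf
  · rw [Ideal.span_le]
    rintro _ ⟨i, rfl⟩
    exact MvPowerSeries.mem_maximalIdeal_iff.2 (MvPowerSeries.constantCoeff_X i)

theorem PowerSeries.isPrecomplete_pi {ι k : Type*} [Field k] :
    IsPrecomplete (Ideal.span {(PowerSeries.X : PowerSeries k)}) (ι → PowerSeries k) := by
  have key : ∀ (m : ℕ) (v w : ι → PowerSeries k),
      v ≡ w [SMOD (Ideal.span {(PowerSeries.X : PowerSeries k)} ^ m • ⊤ :
        Submodule (PowerSeries k) (ι → PowerSeries k))] ↔
      ∀ i, ∀ a < m, PowerSeries.coeff a (v i) = PowerSeries.coeff a (w i) := by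
    intro m v w
    rw [SModEq.sub_mem, Ideal.span_singleton_pow, Submodule.ideal_span_singleton_smul,
      Submodule.mem_smul_pointwise_iff_exists]
    constructor
    · rintro ⟨u, -, hu⟩ i a ha
      have := congrArg (PowerSeries.coeff a) (congrFun hu i)
      rw [← sub_eq_zero, ← map_sub, ← Pi.sub_apply, ← this]
      simp [PowerSeries.coeff_X_pow_mul', ha]
    · intro h
      have : ∀ i, PowerSeries.X ^ m ∣ (v - w) i := fun i => by
        rw [PowerSeries.X_pow_dvd_iff]
        intro a ha
        simp [h i a ha]
      choose u hu using this
      exact ⟨u, trivial, by ext1 i; simp [hu]⟩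
  refine ⟨fun f hf => ⟨fun i => PowerSeries.mk fun a => PowerSeries.coeff a (f (a + 1) i), fun m => ?_⟩⟩
  rw [key]
  intro i a ha
  rw [PowerSeries.coeff_mk]
  exact ((key _ _ _).1 (hf (show a + 1 ≤ m from ha)) i a (by lia)).symm

open scoped PowerSeries in
theorem exists_finite_powerSeries_hom {n : ℕ} (P : Ideal (MvPowerSeries (Fin n) ℂ)) [P.IsPrime]
    (x : MvPowerSeries (Fin n) ℂ) (hx : x ∈ IsLocalRing.maximalIdeal (MvPowerSeries (Fin n) ℂ))
    (hxP : x ∉ P) (N : ℕ)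
    (hN : IsLocalRing.maximalIdeal (MvPowerSeries (Fin n) ℂ) ^ N ≤ P ⊔ Ideal.span {x}) :
    ∃ θ : ℂ⟦X⟧ →+* MvPowerSeries (Fin n) ℂ ⧸ P, Function.Injective θ ∧ θ.Finite ∧
      θ PowerSeries.X = Ideal.Quotient.mk P x ∧
      ∀ c, θ (PowerSeries.C c) = Ideal.Quotient.mk P (MvPowerSeries.C c) := by
  classical
  have hx0 := MvPowerSeries.mem_maximalIdeal_iff.1 hx
  have hs : PowerSeries.HasSubst x := PowerSeries.HasSubst.of_constantCoeff_zero hx0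
  let A := MvPowerSeries (Fin n) ℂ ⧸ P
  let ρ : ℂ⟦X⟧ →+* MvPowerSeries (Fin n) ℂ := (PowerSeries.substAlgHom (R := ℂ) hs).toRingHom
  let θ : ℂ⟦X⟧ →+* A := (Ideal.Quotient.mk P).comp ρ
  have hX : θ PowerSeries.X = Ideal.Quotient.mk P x := by
    change Ideal.Quotient.mk P (PowerSeries.substAlgHom hs PowerSeries.X) = _
    rw [PowerSeries.substAlgHom_X]
  have hC : ∀ c, θ (PowerSeries.C c) = Ideal.Quotient.mk P (MvPowerSeries.C c) := by
    intro c
    change Ideal.Quotient.mk P (PowerSeries.substAlgHom (R := ℂ) hs (algebraMap ℂ ℂ⟦X⟧ c)) = _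
    rw [AlgHom.commutes]
    rfl
  have hxA : Ideal.Quotient.mk P x ≠ 0 := by rwa [Ne, Ideal.Quotient.eq_zero_iff_mem]
  refine ⟨θ, ?_, ?_, hX, hC⟩
  · rw [injective_iff_map_eq_zero]
    intro f hf
    by_contra hf0
    obtain ⟨k, hk⟩ := IsDiscreteValuationRing.associated_pow_irreducible hf0
      PowerSeries.X_prime.irreducible
    have h1 := hk.map θ
    rw [hf, map_pow, hX] at h1
    exact hxA (eq_zero_of_pow_eq_zero ((associated_zero_iff_eq_zero _).1 h1.symm))
  · let : Algebra ℂ⟦X⟧ A := θ.toAlgebra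
    let ι := {α : Fin n →₀ ℕ // α.degree < N}
    have : Finite ι := Finsupp.finite_of_degree_lt N
    have : Fintype ι := Fintype.ofFinite _
    let F : (ι → ℂ⟦X⟧) →ₗ[ℂ⟦X⟧] A :=
      Fintype.linearCombination ℂ⟦X⟧ fun α : ι => Ideal.Quotient.mk P (MvPowerSeries.monomial α.1 1)
    have := PowerSeries.isPrecomplete_pi (ι := ι) (k := ℂ)
    have : IsHausdorff (Ideal.span {(PowerSeries.X : ℂ⟦X⟧)}) A := by
      refine ⟨fun y hy => ?_⟩
      have h1 : y ∈ ⨅ i : ℕ, Ideal.span {Ideal.Quotient.mk P x} ^ i := by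
        rw [Ideal.mem_iInf]
        intro i
        have h2 := hy i
        rw [SModEq.zero, Ideal.span_singleton_pow, Submodule.ideal_span_singleton_smul,
          Submodule.mem_smul_pointwise_iff_exists] at h2
        obtain ⟨u, -, hu⟩ := h2
        rw [← hu, Algebra.smul_def, Ideal.span_singleton_pow, Ideal.mem_span_singleton]
        change _ ∣ θ (PowerSeries.X ^ i) * u
        rw [map_pow, hX]
        exact dvd_mul_right _ _
      rwa [Ideal.iInf_pow_eq_bot_of_isDomain, Ideal.mem_bot] at h1
      rw [Ne, Ideal.span_singleton_eq_top]
      intro h2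
      obtain ⟨y, hy⟩ := h2.exists_right_inv
      obtain ⟨y, rfl⟩ := Ideal.Quotient.mk_surjective y
      rw [← map_mul, ← map_one (Ideal.Quotient.mk P), Ideal.Quotient.eq] at hy
      have h3 := IsLocalRing.le_maximalIdeal (Ideal.IsPrime.ne_top ‹P.IsPrime›) hy
      have h4 : (1 : MvPowerSeries (Fin n) ℂ) ∈ IsLocalRing.maximalIdeal _ := by
        rw [← sub_sub_cancel (x * y) 1]
        exact Ideal.sub_mem _ (Ideal.mul_mem_right _ _ hx) h3
      exact (Ideal.ne_top_iff_one _).1 (IsLocalRing.maximalIdeal.isMaximal _).ne_top h4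
    refine Module.Finite.of_surjective F (surjective_of_mkQ_comp_surjective
      (I := Ideal.span {(PowerSeries.X : ℂ⟦X⟧)}) ?_)
    intro y
    obtain ⟨y, rfl⟩ := Submodule.mkQ_surjective _ y
    obtain ⟨f, rfl⟩ := Ideal.Quotient.mk_surjective y
    refine ⟨fun α => PowerSeries.C (f.coeff α.1), ?_⟩
    rw [LinearMap.comp_apply, Submodule.mkQ_apply, Submodule.mkQ_apply, Submodule.Quotient.eq]
    let g : MvPowerSeries (Fin n) ℂ := ∑ α : ι, MvPowerSeries.monomial α.1 (f.coeff α.1)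
    have hFg : F (fun α => PowerSeries.C (f.coeff α.1)) = Ideal.Quotient.mk P g := by
      rw [map_sum, Fintype.linearCombination_apply]
      refine Finset.sum_congr rfl fun α _ => ?_
      rw [Algebra.smul_def]
      change θ _ * _ = _
      rw [hC, ← map_mul]
      congr 1
      ext β
      simp [MvPowerSeries.coeff_C_mul, MvPowerSeries.coeff_monomial]
    have h1 : g - f ∈ P ⊔ Ideal.span {x} := by
      rw [MvPowerSeries.maximalIdeal_eq_span_X] at hN
      refine hN (MvPowerSeries.mem_span_X_pow _ _ fun α hα => ?_)
      rw [map_sub, map_sum, sub_eq_zero, Finset.sum_eq_single (⟨α, hα⟩ : ι)]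
      · simp
      · intro b _ hb
        rw [MvPowerSeries.coeff_monomial_ne]
        rintro rfl
        exact hb rfl
      · simp
    obtain ⟨p, hp, q, hq, hpq⟩ := Submodule.mem_sup.1 h1
    obtain ⟨c, rfl⟩ := Ideal.mem_span_singleton.1 hq
    rw [hFg, ← map_sub, ← hpq, map_add, Ideal.Quotient.eq_zero_iff_mem.2 hp, zero_add, map_mul,
      Submodule.ideal_span_singleton_smul, Submodule.mem_smul_pointwise_iff_exists]
    refine ⟨Ideal.Quotient.mk P c, trivial, ?_⟩
    rw [Algebra.smul_def, ← hX]
    rfl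

theorem exists_dedekind_arc {n : ℕ} (J : Ideal (MvPowerSeries (Fin n) ℂ))
    (hJ : ∀ N, ¬ IsLocalRing.maximalIdeal (MvPowerSeries (Fin n) ℂ) ^ N ≤ J) :
    ∃ (B : Type) (_ : CommRing B) (_ : IsDedekindDomain B)
      (ψ : MvPowerSeries (Fin n) ℂ →+* B) (Q : Ideal B),
      Q.IsPrime ∧ Q ≠ ⊥ ∧ (∀ f ∈ J, ψ f = 0) ∧ (∀ i, ψ (MvPowerSeries.X i) ∈ Q) ∧
      (∃ i, ψ (MvPowerSeries.X i) ≠ 0) ∧ ∀ b : B, ∃ c : ℂ, b - ψ (MvPowerSeries.C c) ∈ Q := by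
  set m := IsLocalRing.maximalIdeal (MvPowerSeries (Fin n) ℂ) with hm
  have hrad : ∀ I : Ideal (MvPowerSeries (Fin n) ℂ), (∀ P, P.IsPrime → I ≤ P → P = m) →
      ∃ N, m ^ N ≤ I := by
    intro I hI
    refine Ideal.exists_pow_le_of_le_radical_of_fg ?_ (IsNoetherian.noetherian _)
    rw [Ideal.radical_eq_sInf]
    exact le_sInf fun P hP => (hI P hP.2 hP.1).ge
  obtain ⟨P₀, hP₀, hJP₀, hP₀m⟩ : ∃ P : Ideal (MvPowerSeries (Fin n) ℂ),
      P.IsPrime ∧ J ≤ P ∧ P ≠ m := by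
    by_contra! h
    obtain ⟨N, hN⟩ := hrad J h
    exact hJ N hN
  obtain ⟨P, ⟨hP, hJP, hPm⟩, hmax⟩ := WellFounded.has_min
    (wellFounded_gt (α := Ideal (MvPowerSeries (Fin n) ℂ)))
    {P | P.IsPrime ∧ J ≤ P ∧ P ≠ m} ⟨P₀, hP₀, hJP₀, hP₀m⟩
  obtain ⟨i, hi⟩ : ∃ i, MvPowerSeries.X i ∉ P := by
    by_contra! h
    refine hPm (le_antisymm (IsLocalRing.le_maximalIdeal hP.ne_top) ?_)
    rw [hm, MvPowerSeries.maximalIdeal_eq_span_X, Ideal.span_le]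
    rintro _ ⟨i, rfl⟩
    exact h i
  have hXm : ∀ i : Fin n, MvPowerSeries.X i ∈ m := fun i =>
    MvPowerSeries.mem_maximalIdeal_iff.2 (MvPowerSeries.constantCoeff_X i)
  obtain ⟨N, hN⟩ := hrad (P ⊔ Ideal.span {MvPowerSeries.X i}) fun P' hP' hle => by
    by_contra hne
    refine hmax P' ⟨hP', hJP.trans (le_sup_left.trans hle), hne⟩ ?_
    refine lt_of_le_of_ne (le_sup_left.trans hle) ?_
    rintro rfl
    exact hi (hle (Ideal.mem_sup_right (Ideal.mem_span_singleton_self _)))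
  obtain ⟨θ, hθ, hfin, hX, hC⟩ := exists_finite_powerSeries_hom P _ (hXm i) hi N hN
  let : Algebra (PowerSeries ℂ) (MvPowerSeries (Fin n) ℂ ⧸ P) := θ.toAlgebra
  have : Module.Finite (PowerSeries ℂ) (MvPowerSeries (Fin n) ℂ ⧸ P) := hfin
  obtain ⟨B, _, hB, φ, Q, hφ, hQ, hQ0, hQX, hres⟩ :=
    exists_dedekind_extension (MvPowerSeries (Fin n) ℂ ⧸ P) hθ
  change φ (θ _) ∈ Q at hQX
  refine ⟨B, _, hB, φ.comp (Ideal.Quotient.mk P), Q, hQ, hQ0, fun f hf => ?_, fun j => ?_,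
    ⟨i, ?_⟩, fun b => ?_⟩
  · rw [RingHom.comp_apply, Ideal.Quotient.eq_zero_iff_mem.2 (hJP hf), map_zero]
  · obtain ⟨p, hp, q, hq, hpq⟩ := Submodule.mem_sup.1 (hN (Ideal.pow_mem_pow (hXm j) N))
    obtain ⟨c, rfl⟩ := Ideal.mem_span_singleton.1 hq
    refine hQ.mem_of_pow_mem N ?_
    rw [← map_pow, ← hpq, map_add, map_mul, RingHom.comp_apply,
      Ideal.Quotient.eq_zero_iff_mem.2 hp, map_zero, zero_add]
    refine Q.mul_mem_right _ ?_
    rwa [RingHom.comp_apply, ← hX]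
  · rw [RingHom.comp_apply, Ne, map_eq_zero_iff _ hφ, Ideal.Quotient.eq_zero_iff_mem]
    exact hi
  · obtain ⟨c, hc⟩ := hres b
    refine ⟨c, ?_⟩
    rw [RingHom.comp_apply, ← hC]
    exact hc

section Uniformizer

variable {B : Type*} [CommRing B] [IsDedekindDomain B] {Q : Ideal B} [hQ : Q.IsPrime]

theorem Ideal.pow_notMem_pow_succ_of_notMem_sq (hQ0 : Q ≠ ⊥) {τ : B} (hτ : τ ∈ Q)
    (hτ2 : τ ∉ Q ^ 2) (s : ℕ) : τ ^ s ∉ Q ^ (s + 1) := by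
  induction s with
  | zero => simpa using (Ideal.ne_top_iff_one _).1 hQ.ne_top
  | succ s ih =>
    intro hmem
    have h : Q ^ (s + 1) ≤ Q ^ (s + 1 + 1) := by
      conv_lhs => rw [pow_succ]
      rw [Ideal.mul_le]
      intro a ha b hb
      obtain ⟨d, e, he, rfl⟩ := Ideal.exists_mul_add_mem_pow_succ hQ0 _ a
        (Ideal.pow_mem_pow hτ s) ih ha
      obtain ⟨d', e', he', rfl⟩ := Ideal.exists_mul_add_mem_pow_succ (i := 1) hQ0 _ b
        (by simpa using hτ) hτ2 (by simpa using hb)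
      have h1 : (τ ^ s * d + e) * (τ * d' + e') =
          τ ^ (s + 1) * (d * d') + τ ^ s * e' * d + e * (τ * d' + e') := by ring
      rw [h1]
      refine add_mem (add_mem (Ideal.mul_mem_right _ _ hmem) (Ideal.mul_mem_right _ _ ?_)) ?_
      · exact pow_add Q s 2 ▸ Ideal.mul_mem_mul (Ideal.pow_mem_pow hτ s) he'
      · exact pow_succ Q (s + 1) ▸ Ideal.mul_mem_mul he hb
    obtain ⟨x, hx, hx'⟩ := Ideal.exists_mem_pow_notMem_pow_succ Q hQ0 hQ.ne_top (s + 1)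
    exact hx' (h hx)

variable {k : Type*} [Field k] (σ : k →+* B)

open Polynomial in
theorem exists_polynomial_expansion (hQ0 : Q ≠ ⊥) {τ : B} (hτ : τ ∈ Q)
    (hτ2 : τ ∉ Q ^ 2) (hres : ∀ b, ∃ c, b - σ c ∈ Q) {b : B} (hb : b ∈ Q) (T : ℕ) :
    ∃ γ : k[X], γ.coeff 0 = 0 ∧ b - γ.eval₂ σ τ ∈ Q ^ (T + 1) := by
  induction T with
  | zero => exact ⟨0, by simp, by simpa using hb⟩
  | succ T ih =>
    obtain ⟨γ, h0, hγ⟩ := ih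
    obtain ⟨d, e, he, hde⟩ := Ideal.exists_mul_add_mem_pow_succ hQ0 _ _
      (Ideal.pow_mem_pow hτ (T + 1)) (Ideal.pow_notMem_pow_succ_of_notMem_sq hQ0 hτ hτ2 _) hγ
    obtain ⟨c, hc⟩ := hres d
    refine ⟨γ + C c * X ^ (T + 1), by simp [h0], ?_⟩
    have : b - (γ + C c * X ^ (T + 1)).eval₂ σ τ = τ ^ (T + 1) * (d - σ c) + e := by
      rw [eval₂_add, eval₂_mul, eval₂_C, eval₂_pow, eval₂_X, ← sub_sub, ← hde]
      ring
    rw [this]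
    exact add_mem (pow_succ Q (T + 1) ▸ Ideal.mul_mem_mul (Ideal.pow_mem_pow hτ _) hc) he

open Polynomial in
theorem coeff_eq_zero_of_eval₂_mem_pow (hQ0 : Q ≠ ⊥) {τ : B} (hτ : τ ∈ Q)
    (hτ2 : τ ∉ Q ^ 2) {F : k[X]} {T : ℕ} (hF : F.eval₂ σ τ ∈ Q ^ T) :
    ∀ s < T, F.coeff s = 0 := by
  intro s
  induction s using Nat.strong_induction_on with
  | _ s ih =>
    intro hs
    obtain ⟨G, rfl⟩ := X_pow_dvd_iff.2 fun d hd => ih d hd (hd.trans hs)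
    rw [coeff_X_pow_mul', if_pos le_rfl, Nat.sub_self]
    rw [eval₂_mul, eval₂_pow, eval₂_X] at hF
    have h1 : G.eval₂ σ τ ∈ Q := Ideal.mem_prime_of_mul_mem_pow hQ0
      (Ideal.pow_notMem_pow_succ_of_notMem_sq hQ0 hτ hτ2 s) (Ideal.pow_le_pow_right hs hF)
    have h2 : σ (G.coeff 0) ∈ Q := by
      rw [← divX_mul_X_add G, eval₂_add, eval₂_mul, eval₂_X, eval₂_C] at h1
      exact (Q.add_mem_iff_right (Q.mul_mem_left _ hτ)).1 h1
    by_contra h0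
    exact hQ.ne_top (Ideal.eq_top_of_isUnit_mem _ h2 ((IsUnit.mk0 _ h0).map σ))

end Uniformizer

section CurveVec

open Polynomial

/-- The multi-indices of total degree at most `K`. -/
noncomputable def degLE (n K : ℕ) : Finset (Fin n →₀ ℕ) := (Finsupp.finite_of_degree_le K).toFinset

theorem mem_degLE {n K : ℕ} {α : Fin n →₀ ℕ} : α ∈ degLE n K ↔ α.degree ≤ K := by
  simp [degLE]

/-- The pullback of the monomial `z ^ α` along the polynomial curve `g`. -/
noncomputable def curveMonomial {n : ℕ} (g : Fin n → ℂ[X]) (α : Fin n →₀ ℕ) : ℂ[X] :=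
  ∏ i, g i ^ α i

theorem X_pow_dvd_curveMonomial {n ν : ℕ} {g : Fin n → ℂ[X]} (hg : ∀ i, X ^ ν ∣ g i)
    (α : Fin n →₀ ℕ) : X ^ (ν * α.degree) ∣ curveMonomial g α := by
  have : (X : ℂ[X]) ^ (ν * α.degree) = ∏ i, (X ^ ν) ^ α i := by
    rw [Finset.prod_pow_eq_pow_sum, pow_mul, Finsupp.degree_eq_sum]
  rw [this]
  exact Finset.prod_dvd_prod_of_dvd _ _ fun i _ => pow_dvd_pow_of_dvd (hg i) _

theorem coeff_curveMonomial_eq_zero {n ν s : ℕ} {g : Fin n → ℂ[X]} (hg : ∀ i, X ^ ν ∣ g i)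
    {α : Fin n →₀ ℕ} (h : s < ν * α.degree) : (curveMonomial g α).coeff s = 0 :=
  X_pow_dvd_iff.1 (X_pow_dvd_curveMonomial hg α) s h

theorem curveMonomial_add {n : ℕ} (g : Fin n → ℂ[X]) (α β : Fin n →₀ ℕ) :
    curveMonomial g (α + β) = curveMonomial g α * curveMonomial g β := by
  simp [curveMonomial, pow_add, Finset.prod_mul_distrib]

/-- The functional sending a power series `f` to the `s`-th coefficient of `f ∘ g`, as a finitely
supported vector on multi-indices. -/
noncomputable def curveVec {n : ℕ} (g : Fin n → ℂ[X]) (s : ℕ) : (Fin n →₀ ℕ) →₀ ℂ :=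
  ∑ α ∈ degLE n s, Finsupp.single α ((curveMonomial g α).coeff s)

theorem curveVec_apply {n : ℕ} {g : Fin n → ℂ[X]} (hg : ∀ i, X ∣ g i) (s : ℕ)
    (α : Fin n →₀ ℕ) : curveVec g s α = (curveMonomial g α).coeff s := by
  classical
  rw [curveVec, Finsupp.finsetSum_apply]
  simp only [Finsupp.single_apply]
  rw [Finset.sum_ite_eq']
  split_ifs with h
  · rfl
  · rw [mem_degLE] at h
    exact (coeff_curveMonomial_eq_zero (ν := 1) (by simpa using hg) (by lia)).symm

end CurveVec

section Annihilator

variable {n : ℕ}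

/-- The pairing of a power series with a finitely supported vector. -/
noncomputable def seriesPair (f : MvPowerSeries (Fin n) ℂ) : ((Fin n →₀ ℕ) →₀ ℂ) →ₗ[ℂ] ℂ :=
  Finsupp.linearCombination ℂ fun α => f.coeff α

theorem seriesPair_add (f g : MvPowerSeries (Fin n) ℂ) (v : (Fin n →₀ ℕ) →₀ ℂ) :
    seriesPair (f + g) v = seriesPair f v + seriesPair g v := by
  simp [seriesPair, Finsupp.linearCombination_apply, mul_add, Finsupp.sum_add]

theorem seriesPair_monomial_mul (β : Fin n →₀ ℕ) (c : ℂ) (f : MvPowerSeries (Fin n) ℂ)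
    {v w : (Fin n →₀ ℕ) →₀ ℂ} (hw : ∀ α, w α = v (α + β)) :
    seriesPair (MvPowerSeries.monomial β c * f) v = c * seriesPair f w := by
  classical
  simp only [seriesPair, Finsupp.linearCombination_apply, Finsupp.sum, smul_eq_mul,
    MvPowerSeries.coeff_monomial_mul, mul_ite, mul_zero]
  rw [← Finset.sum_filter, Finset.mul_sum]
  refine Finset.sum_nbij' (fun α => α - β) (fun α => α + β) ?_ ?_ ?_ ?_ ?_
  · intro α hα
    simp only [Finset.mem_filter, Finsupp.mem_support_iff] at hα ⊢
    rw [hw, tsub_add_cancel_of_le hα.2]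
    exact hα.1
  · intro α hα
    simp only [Finset.mem_filter, Finsupp.mem_support_iff] at hα ⊢
    rw [← hw]
    exact ⟨hα, le_add_self⟩
  · intro α hα
    exact tsub_add_cancel_of_le (Finset.mem_filter.1 hα).2
  · intro α _
    exact add_tsub_cancel_right _ _
  · intro α hα
    simp only [hw, tsub_add_cancel_of_le (Finset.mem_filter.1 hα).2]
    ring

theorem seriesPair_mul (h f : MvPowerSeries (Fin n) ℂ) (v : (Fin n →₀ ℕ) →₀ ℂ) :
    seriesPair (h * f) v = ∑ β ∈ v.support.biUnion Finset.Iic,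
      seriesPair (MvPowerSeries.monomial β (h.coeff β) * f) v := by
  classical
  simp only [seriesPair, Finsupp.linearCombination_apply, Finsupp.sum, smul_eq_mul]
  rw [Finset.sum_comm]
  refine Finset.sum_congr rfl fun α hα => ?_
  rw [← Finset.mul_sum, ← map_sum, ← Finset.sum_mul, MvPowerSeries.coeff_mul,
    MvPowerSeries.coeff_mul]
  congr 1
  refine Finset.sum_congr rfl fun p hp => ?_
  congr 1
  rw [map_sum, Finset.sum_eq_single p.1]
  · simp
  · intro b _ hb
    rw [MvPowerSeries.coeff_monomial_ne hb.symm]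
  · intro hn
    refine (hn (Finset.mem_biUnion.2 ⟨α, hα, Finset.mem_Iic.2 ?_⟩)).elim
    rw [← Finset.HasAntidiagonal.mem_antidiagonal.1 hp]
    exact le_self_add

/-- The ideal of power series annihilated by a shift-invariant space of vectors. -/
def annihilatorIdeal (S : Submodule ℂ ((Fin n →₀ ℕ) →₀ ℂ))
    (hS : ∀ v ∈ S, ∀ β, ∃ w ∈ S, ∀ α, w α = v (α + β)) : Ideal (MvPowerSeries (Fin n) ℂ) where
  carrier := {f | ∀ v ∈ S, seriesPair f v = 0}
  add_mem' ha hb v hv := by rw [seriesPair_add, ha v hv, hb v hv, add_zero]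
  zero_mem' v _ := by simp [seriesPair, Finsupp.linearCombination_apply]
  smul_mem' h f hf v hv := by
    rw [smul_eq_mul, seriesPair_mul]
    refine Finset.sum_eq_zero fun β _ => ?_
    obtain ⟨w, hw, hwv⟩ := hS v hv β
    rw [seriesPair_monomial_mul β _ f hwv, hf w hw, mul_zero]

open Polynomial in
theorem exists_curve_of_shift_invariant (S : Submodule ℂ ((Fin n →₀ ℕ) →₀ ℂ))
    (hS : ∀ v ∈ S, ∀ β, ∃ w ∈ S, ∀ α, w α = v (α + β))
    (hS' : ∀ N : ℕ, ∃ v ∈ S, ∃ α, N ≤ α.degree ∧ v α ≠ 0) :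
    ∃ a : ℕ, ∀ T : ℕ, ∃ g : Fin n → ℂ[X], (∀ i, X ∣ g i) ∧
      (∃ i, ∃ b ≤ a, (g i).coeff b ≠ 0) ∧ ∀ s ≤ T, curveVec g s ∈ S := by
  obtain ⟨B, _, hB, ψ, Q, hQ, hQ0, hψJ, hψX, ⟨i₀, hi₀⟩, hres⟩ :=
    exists_dedekind_arc (annihilatorIdeal S hS) fun N hN => by
      obtain ⟨v, hv, α, hα, hvα⟩ := hS' N
      have h1 : MvPowerSeries.monomial α (1 : ℂ) ∈ annihilatorIdeal S hS := by
        refine hN ?_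
        rw [MvPowerSeries.maximalIdeal_eq_span_X]
        refine MvPowerSeries.mem_span_X_pow N _ fun β hβ => ?_
        rw [MvPowerSeries.coeff_monomial_ne]
        rintro rfl
        lia
      have h2 := h1 v hv
      classical
      simp only [seriesPair, Finsupp.linearCombination_apply, Finsupp.sum,
        MvPowerSeries.coeff_monomial, smul_eq_mul, mul_ite, mul_one, mul_zero] at h2
      rw [Finset.sum_ite_eq', if_pos (by simpa using hvα)] at h2
      exact hvα h2
  obtain ⟨τ, hτ, hτ2⟩ := Ideal.exists_mem_pow_notMem_pow_succ Q hQ0 hQ.ne_top 1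
  rw [pow_one] at hτ
  let σ : ℂ →+* B := ψ.comp MvPowerSeries.C
  obtain ⟨a, ha⟩ : ∃ a : ℕ, ψ (MvPowerSeries.X i₀) ∉ Q ^ (a + 1) := by
    by_contra! h
    refine hi₀ ?_
    rw [← Ideal.mem_bot, ← Ideal.iInf_pow_eq_bot_of_isDomain Q hQ.ne_top, Ideal.mem_iInf]
    rintro (_ | k)
    · simp
    · exact h k
  refine ⟨a, fun T => ?_⟩
  choose g hg0 hg using fun i =>
    exists_polynomial_expansion σ hQ0 hτ hτ2 hres (hψX i) (max T a)
  have hgX : ∀ i, X ∣ g i := fun i => X_dvd_iff.2 (hg0 i)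
  refine ⟨g, hgX, ?_, ?_⟩
  · by_contra! h
    obtain ⟨G, hG⟩ := X_pow_dvd_iff.2 fun d (hd : d < a + 1) => h i₀ d (by lia)
    refine ha ?_
    rw [← sub_add_cancel (ψ (MvPowerSeries.X i₀)) ((g i₀).eval₂ σ τ)]
    refine add_mem (Ideal.pow_le_pow_right (by lia) (hg i₀)) ?_
    rw [hG, eval₂_mul, eval₂_pow, eval₂_X]
    exact Ideal.mul_mem_right _ _ (Ideal.pow_mem_pow hτ _)
  · intro s hs
    by_contra hmem
    obtain ⟨f, hf, hSf⟩ := Submodule.exists_le_ker_of_notMem hmem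
    let F : MvPowerSeries (Fin n) ℂ := fun α => f (Finsupp.single α 1)
    have hFf : seriesPair F = f := by
      ext α
      simp only [seriesPair, LinearMap.comp_apply, Finsupp.lsingle_apply,
        Finsupp.linearCombination_single, one_smul]
      rfl
    have hF : ψ F = 0 := hψJ F fun v hv => by rw [hFf]; exact hSf hv
    set T' := max T a
    let F₀ : MvPowerSeries (Fin n) ℂ := ∑ α ∈ degLE n T', MvPowerSeries.monomial α (F.coeff α)
    let G : ℂ[X] := ∑ α ∈ degLE n T', C (F.coeff α) * curveMonomial g α
    have hrest : ψ (F - F₀) ∈ Q ^ (T' + 1) := by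
      have h1 : F - F₀ ∈ Ideal.span (Set.range MvPowerSeries.X) ^ (T' + 1) := by
        refine MvPowerSeries.mem_span_X_pow _ _ fun α hα => ?_
        rw [map_sub, map_sum, sub_eq_zero, Finset.sum_eq_single α]
        · simp
        · intro b _ hb
          rw [MvPowerSeries.coeff_monomial_ne hb.symm]
        · intro h
          exact (h (mem_degLE.2 (by lia))).elim
      refine (Ideal.map_le_iff_le_comap.1 ?_ : _ ≤ (Q ^ (T' + 1)).comap ψ) h1
      rw [Ideal.map_pow]
      refine Ideal.pow_right_mono ?_ _
      rw [Ideal.map_span, Ideal.span_le]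
      rintro _ ⟨_, ⟨i, rfl⟩, rfl⟩
      exact hψX i
    have hF₀G : ψ F₀ - G.eval₂ σ τ ∈ Q ^ (T' + 1) := by
      rw [map_sum, eval₂_finsetSum, ← Finset.sum_sub_distrib]
      refine Ideal.sum_mem _ fun α _ => ?_
      rw [← Ideal.Quotient.eq, MvPowerSeries.monomial_eq', map_mul, map_mul, eval₂_mul, eval₂_C,
        map_mul]
      congr 1
      rw [Finsupp.prod_fintype _ _ (by simp), curveMonomial, eval₂_finsetProd, map_prod, map_prod,
        map_prod]
      refine Finset.prod_congr rfl fun i _ => ?_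
      rw [map_pow, map_pow, eval₂_pow, map_pow]
      congr 1
      exact Ideal.Quotient.eq.2 (hg i)
    have hG : G.eval₂ σ τ ∈ Q ^ (T' + 1) := by
      have h1 : G.eval₂ σ τ = ψ F - ψ (F - F₀) - (ψ F₀ - G.eval₂ σ τ) := by
        rw [map_sub]; ring
      rw [h1, hF, zero_sub]
      exact sub_mem (neg_mem hrest) hF₀G
    have h0 := coeff_eq_zero_of_eval₂_mem_pow σ hQ0 hτ hτ2 hG s (by lia)
    refine hf ?_
    rw [← hFf, curveVec, map_sum, ← h0, finsetSum_coeff]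
    rw [Finset.sum_subset (s₁ := degLE n s) (s₂ := degLE n T')]
    · refine Finset.sum_congr rfl fun α _ => ?_
      rw [seriesPair, Finsupp.linearCombination_single, coeff_C_mul, smul_eq_mul, mul_comm]
    · intro α hα
      rw [mem_degLE] at hα ⊢
      lia
    · intro α _ hα
      rw [mem_degLE] at hα
      rw [coeff_curveMonomial_eq_zero (ν := 1) (by simpa using hgX) (by lia), Finsupp.single_zero,
        map_zero]

end Annihilator

section Limits

open Filter

theorem exists_linearIndependent_limits {E : Type*} [NormedAddCommGroup E] [InnerProductSpace ℂ E]
    [FiniteDimensional ℂ E] (𝒰 : Ultrafilter ℕ) (V : ℕ → Submodule ℂ E) {k : ℕ}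
    (h : ∀ j, ∃ v : Fin k → E, LinearIndependent ℂ v ∧ ∀ i, v i ∈ V j) :
    ∃ w : Fin k → E, LinearIndependent ℂ w ∧
      ∀ i, ∃ l : ℕ → E, (∀ j, l j ∈ V j) ∧ Tendsto l 𝒰 (𝓝 (w i)) := by
  have h' : ∀ j, ∃ u : Fin k → E, Orthonormal ℂ u ∧ ∀ i, u i ∈ V j := by
    intro j
    obtain ⟨v, hv, hvV⟩ := h j
    refine ⟨InnerProductSpace.gramSchmidtNormed ℂ v,
      InnerProductSpace.gramSchmidtNormed_orthonormal hv, fun i => ?_⟩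
    have h1 : InnerProductSpace.gramSchmidtNormed ℂ v i ∈ Submodule.span ℂ (Set.range v) := by
      rw [← InnerProductSpace.span_gramSchmidt, ← InnerProductSpace.span_gramSchmidtNormed_range]
      exact Submodule.subset_span ⟨i, rfl⟩
    exact Submodule.span_le.2 (by rintro _ ⟨i, rfl⟩; exact hvV i) h1
  choose u hu huV using h'
  have : ProperSpace E := FiniteDimensional.proper ℂ E
  have hlim : ∀ i, ∃ w : E, Tendsto (fun j => u j i) 𝒰 (𝓝 w) := by
    intro i
    obtain ⟨w, -, hw⟩ := (isCompact_iff_ultrafilter_le_nhds.1 (isCompact_closedBall (0 : E) 1))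
      (𝒰.map fun j => u j i) (by
        rw [le_principal_iff, Ultrafilter.coe_map, mem_map]
        exact Eventually.of_forall fun j => by simp [(hu j).1 i])
    exact ⟨w, hw⟩
  choose w hw using hlim
  refine ⟨w, Orthonormal.linearIndependent ⟨fun i => ?_, fun a b hab => ?_⟩,
    fun i => ⟨fun j => u j i, fun j => huV j i, hw i⟩⟩
  · refine tendsto_nhds_unique (hw i).norm ?_
    simp [(hu _).1 i]
  · refine tendsto_nhds_unique ((hw a).inner (hw b)) ?_
    simp [(hu _).2 hab]

variable {σ : Type*}

/-- The pointwise limits along an ultrafilter of sequences of vectors taken in given subspaces. -/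
noncomputable def limitSubmodule (𝒰 : Ultrafilter ℕ) (V : ℕ → Submodule ℂ (σ →₀ ℂ)) :
    Submodule ℂ (σ →₀ ℂ) where
  carrier := {x | ∃ l : ℕ → σ →₀ ℂ, (∀ j, l j ∈ V j) ∧
    ∀ α, Tendsto (fun j => l j α) 𝒰 (𝓝 (x α))}
  zero_mem' := ⟨fun _ => 0, fun j => (V j).zero_mem, fun α => by simp⟩
  add_mem' := by
    rintro x y ⟨l, hl, hlx⟩ ⟨m, hm, hmy⟩
    exact ⟨fun j => l j + m j, fun j => (V j).add_mem (hl j) (hm j),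
      fun α => by simpa using (hlx α).add (hmy α)⟩
  smul_mem' := by
    rintro c x ⟨l, hl, hlx⟩
    exact ⟨fun j => c • l j, fun j => (V j).smul_mem c (hl j),
      fun α => by simpa using (hlx α).const_mul c⟩

theorem mem_limitSubmodule {𝒰 : Ultrafilter ℕ} {V : ℕ → Submodule ℂ (σ →₀ ℂ)} {x : σ →₀ ℂ} :
    x ∈ limitSubmodule 𝒰 V ↔ ∃ l : ℕ → σ →₀ ℂ, (∀ j, l j ∈ V j) ∧
      ∀ α, Tendsto (fun j => l j α) 𝒰 (𝓝 (x α)) := Iff.rfl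

theorem limitSubmodule_mono {𝒰 : Ultrafilter ℕ} {V W : ℕ → Submodule ℂ (σ →₀ ℂ)}
    (h : ∀ j, V j ≤ W j) : limitSubmodule 𝒰 V ≤ limitSubmodule 𝒰 W := by
  rintro x ⟨l, hl, hlx⟩
  exact ⟨l, fun j => h j (hl j), hlx⟩

theorem exists_linearIndependent_limitSubmodule (𝒰 : Ultrafilter ℕ)
    (V : ℕ → Submodule ℂ (σ →₀ ℂ)) {A : Finset σ} (hA : ∀ j, ∀ v ∈ V j, ∀ α ∉ A, v α = 0) {k : ℕ}
    (h : ∀ j, ∃ v : Fin k → σ →₀ ℂ, LinearIndependent ℂ v ∧ ∀ i, v i ∈ V j) :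
    ∃ w : Fin k → σ →₀ ℂ, LinearIndependent ℂ w ∧ ∀ i, w i ∈ limitSubmodule 𝒰 V := by
  classical
  let ext : EuclideanSpace ℂ A →ₗ[ℂ] (σ →₀ ℂ) :=
    ∑ a : A, (Finsupp.lsingle (a : σ)).comp (EuclideanSpace.proj a).toLinearMap
  have ext_apply : ∀ (e : EuclideanSpace ℂ A) (α : σ),
      ext e α = if hα : α ∈ A then e ⟨α, hα⟩ else 0 := by
    intro e α
    simp only [ext, LinearMap.sum_apply, LinearMap.comp_apply, Finsupp.finsetSum_apply,
      Finsupp.lsingle_apply, Finsupp.single_apply]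
    split_ifs with hα
    · rw [Finset.sum_eq_single ⟨α, hα⟩]
      · simp
      · intro b _ hb
        rw [if_neg]
        rintro rfl
        exact hb rfl
      · simp
    · exact Finset.sum_eq_zero fun b _ => if_neg (by rintro rfl; exact hα b.2)
  have ext_inj : Function.Injective ext := by
    intro e e' he
    ext a
    have := DFunLike.congr_fun he (a : σ)
    simpa [ext_apply] using this
  have ext_surj : ∀ v : σ →₀ ℂ, (∀ α ∉ A, v α = 0) → ∃ e, ext e = v := by
    intro v hv
    refine ⟨WithLp.toLp 2 fun a => v a, ?_⟩
    ext α
    rw [ext_apply]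
    split_ifs with hα
    · rfl
    · exact (hv α hα).symm
  obtain ⟨w, hw, hwl⟩ := exists_linearIndependent_limits 𝒰 (fun j => (V j).comap ext) (k := k) (by
    intro j
    obtain ⟨v, hv, hvV⟩ := h j
    choose e he using fun i => ext_surj (v i) (hA j _ (hvV i))
    refine ⟨e, ?_, fun i => ?_⟩
    · refine LinearIndependent.of_comp ext ?_
      convert hv using 1
      exact funext he
    · rw [Submodule.mem_comap, he]
      exact hvV i)
  refine ⟨ext ∘ w, hw.map' ext (LinearMap.ker_eq_bot.2 ext_inj), fun i => ?_⟩
  obtain ⟨l, hl, hlw⟩ := hwl i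
  refine ⟨fun j => ext (l j), hl, fun α => ?_⟩
  simp only [ext_apply, Function.comp_apply]
  split_ifs with hα
  · exact ((EuclideanSpace.proj (𝕜 := ℂ) (⟨α, hα⟩ : A)).continuous.tendsto _).comp hlw
  · exact tendsto_const_nhds

end Limits

section CurveSpace

open Polynomial

variable {n : ℕ}

/-- The span of the coefficient functionals of order less than `N` of a curve. -/
noncomputable def curveSpace (g : Fin n → ℂ[X]) (N : ℕ) : Submodule ℂ ((Fin n →₀ ℕ) →₀ ℂ) :=
  Submodule.span ℂ {v | ∃ a < N, v = curveVec g a}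

theorem curveVec_mem_curveSpace (g : Fin n → ℂ[X]) {a N : ℕ} (h : a < N) :
    curveVec g a ∈ curveSpace g N := Submodule.subset_span ⟨a, h, rfl⟩

theorem curveSpace_mono (g : Fin n → ℂ[X]) {N N' : ℕ} (h : N ≤ N') :
    curveSpace g N ≤ curveSpace g N' :=
  Submodule.span_mono fun _ ⟨a, ha, hv⟩ => ⟨a, ha.trans_le h, hv⟩

theorem curveSpace_apply_eq_zero {g : Fin n → ℂ[X]} {ν : ℕ} (hν : ν ≠ 0) (hg : ∀ i, X ^ ν ∣ g i)
    {k : ℕ} {v : (Fin n →₀ ℕ) →₀ ℂ} (hv : v ∈ curveSpace g (k * ν)) {α : Fin n →₀ ℕ}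
    (hα : k ≤ α.degree) : v α = 0 := by
  have hg1 : ∀ i, X ∣ g i := fun i => (dvd_pow_self X hν).trans (hg i)
  induction hv using Submodule.span_induction with
  | mem v hv =>
    obtain ⟨a, ha, rfl⟩ := hv
    rw [curveVec_apply hg1]
    exact coeff_curveMonomial_eq_zero hg (ha.trans_le (by rw [mul_comm]; gcongr))
  | zero => rfl
  | add v w _ _ hv hw => simp [hv, hw]
  | smul c v _ hv => simp [hv]

theorem curveSpace_shift {g : Fin n → ℂ[X]} (hg : ∀ i, X ∣ g i) (N : ℕ) (β : Fin n →₀ ℕ)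
    {v : (Fin n →₀ ℕ) →₀ ℂ} (hv : v ∈ curveSpace g N) :
    Finsupp.lcomapDomain (R := ℂ) (· + β) (add_left_injective β) v ∈ curveSpace g N := by
  suffices curveSpace g N ≤ (curveSpace g N).comap
      (Finsupp.lcomapDomain (R := ℂ) (· + β) (add_left_injective β)) from this hv
  refine Submodule.span_le.2 ?_
  rintro _ ⟨a, ha, rfl⟩
  have : Finsupp.lcomapDomain (R := ℂ) (· + β) (add_left_injective β) (curveVec g a) =
      ∑ x ∈ Finset.HasAntidiagonal.antidiagonal a, (curveMonomial g β).coeff x.2 • curveVec g x.1 := by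
    ext α
    rw [Finsupp.finsetSum_apply]
    simp only [Finsupp.smul_apply, curveVec_apply hg, smul_eq_mul]
    change curveVec g a (α + β) = _
    rw [curveVec_apply hg, curveMonomial_add, coeff_mul]
    exact Finset.sum_congr rfl fun x _ => mul_comm _ _
  rw [SetLike.mem_coe, Submodule.mem_comap, this]
  refine Submodule.sum_mem _ fun x hx => Submodule.smul_mem _ _ (curveVec_mem_curveSpace g ?_)
  have := Finset.HasAntidiagonal.mem_antidiagonal.1 hx
  lia

theorem linearIndependent_curveVec {g : Fin n → ℂ[X]} {ν : ℕ} (hν : ν ≠ 0)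
    (hg : ∀ i, X ^ ν ∣ g i) {i : Fin n} (hi : (g i).coeff ν ≠ 0) (k : ℕ) :
    LinearIndependent ℂ fun b : Fin k => curveVec g (b * ν) := by
  classical
  have hg1 : ∀ i, X ∣ g i := fun i => (dvd_pow_self X hν).trans (hg i)
  obtain ⟨q, hq⟩ := hg i
  have hval : ∀ b c : ℕ, b ≤ c → curveVec g (b * ν) (Finsupp.single i c) =
      if b = c then (g i).coeff ν ^ c else 0 := by
    intro b c hbc
    have hm : curveMonomial g (Finsupp.single i c) = X ^ (c * ν) * q ^ c := by
      rw [curveMonomial, Finset.prod_eq_single i]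
      · rw [Finsupp.single_eq_same, hq, mul_pow, ← pow_mul, mul_comm ν]
      · intro j _ hj
        simp [hj.symm]
      · simp
    rw [curveVec_apply hg1, hm, coeff_X_pow_mul']
    split_ifs with h1 h2 h2
    · subst h2
      rw [hq, coeff_X_pow_mul', if_pos le_rfl, Nat.sub_self, Nat.sub_self]
      simp [coeff_zero_eq_eval_zero]
    · exact absurd (le_antisymm hbc (Nat.le_of_mul_le_mul_right h1 (Nat.pos_of_ne_zero hν))) h2
    · exact absurd (by rw [h2]) h1
    · rfl
  rw [Fintype.linearIndependent_iff]
  intro x hx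
  by_contra! hne
  obtain ⟨c, hc, hmax⟩ := Finset.exists_max_image (Finset.univ.filter fun b => x b ≠ 0)
    (fun b => b) (by simpa [Finset.Nonempty] using hne)
  simp only [Finset.mem_filter, Finset.mem_univ, true_and] at hc hmax
  have h0 := DFunLike.congr_fun hx (Finsupp.single i (c : ℕ))
  rw [Finsupp.finsetSum_apply, Finset.sum_eq_single c] at h0
  · rw [Finsupp.smul_apply, hval _ _ le_rfl, if_pos rfl] at h0
    simp [hc, hi] at h0
  · intro b _ hb
    by_cases hxb : x b = 0
    · simp [hxb]
    · have hlt : b < c := lt_of_le_of_ne (hmax b hxb) hb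
      rw [Finsupp.smul_apply, hval _ _ (by exact_mod_cast hlt.le), if_neg (by
        exact Fin.val_ne_of_ne hlt.ne), smul_zero]
  · simp

/-- Limits of the coefficient functionals of a sequence of curves produce a single curve. -/
theorem exists_curve_of_limit (𝒰 : Ultrafilter ℕ) (g : ℕ → Fin n → ℂ[X]) (ν : ℕ → ℕ)
    (hν : ∀ j, ν j ≠ 0) (hg : ∀ j i, X ^ ν j ∣ g j i) (hgν : ∀ j, ∃ i, (g j i).coeff (ν j) ≠ 0) :
    ∃ a, ∀ T, ∃ f : Fin n → ℂ[X], (∀ i, X ∣ f i) ∧ (∃ i, ∃ b ≤ a, (f i).coeff b ≠ 0) ∧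
      ∃ K, ∀ k ≥ K, ∀ s ≤ T, curveVec f s ∈ limitSubmodule 𝒰 fun j => curveSpace (g j) (k * ν j) := by
  set L : ℕ → Submodule ℂ ((Fin n →₀ ℕ) →₀ ℂ) :=
    fun k => limitSubmodule 𝒰 fun j => curveSpace (g j) (k * ν j) with hL
  have hLmono : Monotone L := fun k k' h =>
    limitSubmodule_mono fun j => curveSpace_mono _ (by gcongr)
  have hmem : ∀ {x}, x ∈ ⨆ k, L k ↔ ∃ k, x ∈ L k := fun {x} =>
    Submodule.mem_iSup_of_directed _ hLmono.directed_le
  obtain ⟨a, ha⟩ := exists_curve_of_shift_invariant (⨆ k, L k) (by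
    intro v hv β
    obtain ⟨k, l, hl, hlv⟩ := hmem.1 hv
    refine ⟨Finsupp.lcomapDomain (R := ℂ) (· + β) (add_left_injective β) v, hmem.2 ⟨k, fun j =>
      Finsupp.lcomapDomain (R := ℂ) (· + β) (add_left_injective β) (l j), fun j => ?_,
      fun α => hlv (α + β)⟩, fun α => rfl⟩
    exact curveSpace_shift (fun i => (dvd_pow_self X (hν j)).trans (hg j i)) _ _ (hl j)) (by
    intro N
    by_contra! hN
    let B := Finsupp.supported ℂ ℂ (degLE n N : Set (Fin n →₀ ℕ))
    have : FiniteDimensional ℂ B :=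
      (Finsupp.supportedEquivFinsupp (M := ℂ) (R := ℂ)
        (degLE n N : Set (Fin n →₀ ℕ))).symm.finiteDimensional
    have hB : ∀ k, ∃ w : Fin k → B, LinearIndependent ℂ w := by
      intro k
      obtain ⟨w, hw, hwL⟩ := exists_linearIndependent_limitSubmodule 𝒰
        (fun j => curveSpace (g j) (k * ν j)) (A := degLE n k) (k := k)
        (fun j v hv α hα => curveSpace_apply_eq_zero (hν j) (hg j) hv (by
          rw [mem_degLE] at hα; lia))
        (fun j => ⟨_, linearIndependent_curveVec (hν j) (hg j) (hgν j).choose_spec k,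
          fun i => curveVec_mem_curveSpace _
            (Nat.mul_lt_mul_of_pos_right i.2 (Nat.pos_of_ne_zero (hν j)))⟩)
      refine ⟨fun i => ⟨w i, ?_⟩, LinearIndependent.of_comp B.subtype hw⟩
      rw [Finsupp.mem_supported']
      intro α hα
      refine hN _ (hmem.2 ⟨k, hwL i⟩) α ?_
      rw [Finset.mem_coe, mem_degLE] at hα
      lia
    obtain ⟨w, hw⟩ := hB (Module.finrank ℂ B + 1)
    have := hw.fintype_card_le_finrank
    simp at this)
  refine ⟨a, fun T => ?_⟩
  obtain ⟨f, hf, hfb, hfs⟩ := ha T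
  refine ⟨f, hf, hfb, ?_⟩
  choose! k hk using fun s (hs : s ≤ T) => hmem.1 (hfs s hs)
  refine ⟨(Finset.range (T + 1)).sup k, fun K hK s hs => ?_⟩
  exact hLmono ((Finset.le_sup (f := k) (Finset.mem_range.2 (by lia))).trans hK) (hk s hs)

end CurveSpace

section Taylor

open Asymptotics Filter Set

variable {E F : Type*} [NormedAddCommGroup E] [NormedSpace ℝ E]
  [NormedAddCommGroup F] [NormedSpace ℝ F]

theorem norm_sub_taylor_le {φ : ℕ → ℝ → F} {C : ℝ} (K : ℕ)
    (hφ : ∀ m < K, ∀ s ∈ Icc (0 : ℝ) 1, HasDerivWithinAt (φ m) (φ (m + 1) s) (Icc 0 1) s)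
    (hC : ∀ s ∈ Icc (0 : ℝ) 1, ‖φ K s‖ ≤ C) :
    ∀ s ∈ Icc (0 : ℝ) 1,
      ‖φ 0 s - ∑ m ∈ Finset.range K, (s ^ m * (m.factorial : ℝ)⁻¹) • φ m 0‖ ≤ C := by
  induction K generalizing φ with
  | zero => simpa using hC
  | succ K ih =>
    intro s hs
    have hC0 : 0 ≤ C := (norm_nonneg _).trans (hC 0 (by simp))
    have h1 := ih (φ := fun m => φ (m + 1)) (fun m hm => hφ (m + 1) (by lia)) hC
    have hder : ∀ x ∈ Icc (0 : ℝ) 1, HasDerivWithinAt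
        (fun s => φ 0 s - ∑ m ∈ Finset.range (K + 1), (s ^ m * (m.factorial : ℝ)⁻¹) • φ m 0)
        (φ 1 x - ∑ m ∈ Finset.range K, (x ^ m * (m.factorial : ℝ)⁻¹) • φ (m + 1) 0)
        (Icc 0 1) x := by
      intro x hx
      refine (hφ 0 (by lia) x hx).sub ?_
      have := HasDerivWithinAt.fun_sum (u := Finset.range (K + 1)) (x := x) (s := Icc (0 : ℝ) 1)
        (A := fun m s => (s ^ m * (m.factorial : ℝ)⁻¹) • φ m 0)
        (A' := fun m => (m * x ^ (m - 1) * (m.factorial : ℝ)⁻¹) • φ m 0)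
        (fun m _ => (((hasDerivAt_pow m x).mul_const _).smul_const _).hasDerivWithinAt)
      convert this using 1
      rw [Finset.sum_range_succ']
      simp only [CharP.cast_eq_zero, zero_mul, zero_smul, add_zero]
      refine Finset.sum_congr rfl fun m _ => ?_
      congr 1
      rw [Nat.factorial_succ, add_tsub_cancel_right]
      push_cast
      have : (m.factorial : ℝ) ≠ 0 := by positivity
      field_simp
    have h2 := norm_image_sub_le_of_norm_deriv_le_segment' hder
      (fun x hx => h1 x (Ico_subset_Icc_self hx)) s hs
    have h3 : φ 0 0 - ∑ m ∈ Finset.range (K + 1), ((0 : ℝ) ^ m * (m.factorial : ℝ)⁻¹) • φ m 0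
        = 0 := by
      rw [Finset.sum_range_succ']
      simp
    rw [h3, sub_zero] at h2
    refine h2.trans ?_
    have := hs.2
    rw [sub_zero]
    nlinarith

theorem isBigO_sub_taylor {f : E → F} {q : E} (hf : ContDiffAt ℝ (⊤ : ℕ∞) f q) (K : ℕ) :
    (fun h => f (q + h) - ∑ m ∈ Finset.range K,
      (m.factorial : ℝ)⁻¹ • iteratedFDeriv ℝ m f q fun _ => h) =O[𝓝 0] fun h => ‖h‖ ^ K := by
  have hfK : ContDiffAt ℝ K f q := hf.of_le (by exact_mod_cast le_top)
  have hev : ∀ᶠ x in 𝓝 q, ContDiffAt ℝ K f x := hfK.eventually (by simp)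
  have hcont : ContinuousAt (fun x => ‖iteratedFDeriv ℝ K f x‖) q :=
    (hfK.continuousAt_iteratedFDeriv le_rfl).norm
  have hev2 : ∀ᶠ x in 𝓝 q, ‖iteratedFDeriv ℝ K f x‖ < ‖iteratedFDeriv ℝ K f q‖ + 1 :=
    hcont.eventually_lt_const (by linarith)
  obtain ⟨ε, hε, hball⟩ := Metric.eventually_nhds_iff_ball.1 (hev.and hev2)
  refine IsBigO.of_bound (‖iteratedFDeriv ℝ K f q‖ + 1) ?_
  filter_upwards [Metric.ball_mem_nhds (0 : E) hε] with h hh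
  have hmem : ∀ s ∈ Icc (0 : ℝ) 1, q + s • h ∈ Metric.ball q ε := by
    intro s hs
    rw [mem_ball_zero_iff] at hh
    rw [Metric.mem_ball, dist_eq_norm, add_sub_cancel_left, norm_smul, Real.norm_eq_abs,
      abs_of_nonneg hs.1]
    exact (mul_le_of_le_one_left (norm_nonneg _) hs.2).trans_lt hh
  have := norm_sub_taylor_le (φ := fun m s => iteratedFDeriv ℝ m f (q + s • h) fun _ => h)
    (C := (‖iteratedFDeriv ℝ K f q‖ + 1) * ‖h‖ ^ K) K (fun m hm s hs => ?_) (fun s hs => ?_) 1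
    (by simp)
  · simpa using this
  · have hd : DifferentiableAt ℝ (iteratedFDeriv ℝ m f) (q + s • h) :=
      (hball _ (hmem s hs)).1.differentiableAt_iteratedFDeriv (by exact_mod_cast hm)
    have hl : HasDerivAt (fun s : ℝ => q + s • h) h s := by
      simpa using ((hasDerivAt_id s).smul_const h).const_add q
    have hc := hd.hasFDerivAt.comp_hasDerivAt s hl
    have := ((ContinuousMultilinearMap.apply ℝ (fun _ : Fin m => E) F fun _ => h).hasFDerivAt
      (x := iteratedFDeriv ℝ m f (q + s • h))).comp_hasDerivAt s hc
    refine HasDerivAt.hasDerivWithinAt ?_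
    simpa [Function.comp_def, iteratedFDeriv_succ_apply_left, Fin.tail_def] using this
  · refine (ContinuousMultilinearMap.le_opNorm _ _).trans ?_
    rw [Finset.prod_const, Finset.card_univ, Fintype.card_fin]
    gcongr
    exact (hball _ (hmem s hs)).2.le

end Taylor

section Symmetric

open Equiv

universe u

variable {E : Type u} [NormedAddCommGroup E] [NormedSpace ℝ E]

theorem iteratedFDeriv_comp_swap_castSucc_succ (l : ℕ) :
    ∀ {F : Type u} [NormedAddCommGroup F] [NormedSpace ℝ F] {f : E → F} {x : E},
      ContDiffAt ℝ (l + 1 : ℕ) f x → ∀ (i : Fin l) (v : Fin (l + 1) → E),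
      iteratedFDeriv ℝ (l + 1) f x (v ∘ swap i.castSucc i.succ) =
        iteratedFDeriv ℝ (l + 1) f x v := by
  induction l with
  | zero => exact fun _ i => i.elim0
  | succ l ih =>
    intro F _ _ f x hf i v
    induction i using Fin.cases with
    | zero =>
      cases l with
      | zero =>
        have hs : IsSymmSndFDerivAt ℝ f x :=
          hf.isSymmSndFDerivAt (by simp [minSmoothness_of_isRCLikeNormedField])
        have := hs (v 1) (v 0)
        simpa [iteratedFDeriv_two_apply] using this
      | succ l =>
        have hf' : ContDiffAt ℝ (l + 1 + 1 : ℕ) (fderiv ℝ f) x := hf.fderiv_right (by simp)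
        have := ih hf' 0 (Fin.init v)
        rw [iteratedFDeriv_succ_apply_right, iteratedFDeriv_succ_apply_right (m := v), ← this]
        have hinit : Fin.init (v ∘ swap (Fin.castSucc 0) (Fin.succ 0)) =
            Fin.init v ∘ swap (Fin.castSucc (0 : Fin (l + 1))) (Fin.succ 0) := by
          funext m
          simp only [Fin.init_def, Function.comp_apply]
          congr 1
          simp only [swap_apply_def, Fin.ext_iff]
          split_ifs <;> simp_all
        rw [hinit]
        congr 1
    | succ i =>
      have hσ0 : swap i.succ.castSucc i.succ.succ 0 = 0 :=
        swap_apply_of_ne_of_ne (by simp [Fin.ext_iff]) (by simp [Fin.ext_iff])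
      have htail : Fin.tail (v ∘ swap i.succ.castSucc i.succ.succ) =
          Fin.tail v ∘ swap i.castSucc i.succ := by
        funext m
        simp only [Fin.tail_def, Function.comp_apply]
        congr 1
        simp only [swap_apply_def, Fin.ext_iff]
        split_ifs <;> simp_all
      have hd : DifferentiableAt ℝ (iteratedFDeriv ℝ (l + 1) f) x :=
        hf.differentiableAt_iteratedFDeriv (by exact_mod_cast Nat.lt_succ_self _)
      have hev : ∀ᶠ y in 𝓝 x, ContDiffAt ℝ (l + 1 : ℕ) f y :=
        (hf.of_le (m := (l + 1 : ℕ)) (by exact_mod_cast Nat.le_succ _)).eventually (by simp)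
      have happ : ∀ w : Fin (l + 1) → E, fderiv ℝ (iteratedFDeriv ℝ (l + 1) f) x (v 0) w =
          fderiv ℝ (fun y => iteratedFDeriv ℝ (l + 1) f y w) x (v 0) := by
        intro w
        have := ((ContinuousMultilinearMap.apply ℝ (fun _ : Fin (l + 1) => E) F w).hasFDerivAt.comp
          x hd.hasFDerivAt).fderiv
        exact (DFunLike.congr_fun this (v 0)).symm
      rw [iteratedFDeriv_succ_apply_left, iteratedFDeriv_succ_apply_left, Function.comp_apply,
        hσ0, htail, happ, happ]
      congr 1
      exact Filter.EventuallyEq.fderiv_eq (hev.mono fun y hy => ih hy i (Fin.tail v))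

theorem iteratedFDeriv_comp_perm_of_contDiffAt {F : Type u} [NormedAddCommGroup F]
    [NormedSpace ℝ F] {f : E → F} {x : E} (hf : ContDiffAt ℝ (⊤ : ℕ∞) f x) {l : ℕ}
    (σ : Perm (Fin l)) (v : Fin l → E) :
    iteratedFDeriv ℝ l f x (v ∘ σ) = iteratedFDeriv ℝ l f x v := by
  cases l with
  | zero => rw [Subsingleton.elim σ 1]; rfl
  | succ l =>
    have hσ : σ ∈ Submonoid.closure (Set.range fun i : Fin l => swap i.castSucc i.succ) := by
      rw [Perm.mclosure_swap_castSucc_succ]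
      trivial
    induction hσ using Submonoid.closure_induction generalizing v with
    | mem σ hσ =>
      obtain ⟨i, rfl⟩ := hσ
      exact iteratedFDeriv_comp_swap_castSucc_succ l (hf.of_le (by exact_mod_cast le_top)) i v
    | one => rfl
    | mul σ τ _ _ h1 h2 => rw [Perm.coe_mul, ← Function.comp_assoc, h2, h1]

end Symmetric

section VanishingOrder

open Asymptotics Filter

theorem eq_zero_of_sum_pow_smul_isBigO {F : Type*} [NormedAddCommGroup F] [NormedSpace ℝ F]
    {N M : ℕ} {a : ℕ → F}
    (h : (fun s : ℝ => ∑ m ∈ Finset.range N, s ^ m • a m) =O[𝓝[>] 0] fun s => s ^ M) :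
    ∀ m < N, m < M → a m = 0 := by
  induction M generalizing N a with
  | zero => lia
  | succ M ih =>
    cases N with
    | zero => lia
    | succ N =>
      have hsum : ∀ s : ℝ, ∑ m ∈ Finset.range (N + 1), s ^ m • a m =
          s • ∑ m ∈ Finset.range N, s ^ m • a (m + 1) + a 0 := by
        intro s
        rw [Finset.sum_range_succ', Finset.smul_sum]
        simp [pow_succ', mul_smul]
      have h0 : a 0 = 0 := by
        have h1 : Tendsto (fun s : ℝ => ∑ m ∈ Finset.range (N + 1), s ^ m • a m) (𝓝[>] 0)
            (𝓝 0) := by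
          refine h.trans_tendsto ?_
          have : Tendsto (fun s : ℝ => s ^ (M + 1)) (𝓝 0) (𝓝 (0 ^ (M + 1))) :=
            (continuous_pow _).tendsto 0
          rw [zero_pow (by lia)] at this
          exact this.mono_left nhdsWithin_le_nhds
        have h2 : Tendsto (fun s : ℝ => ∑ m ∈ Finset.range (N + 1), s ^ m • a m) (𝓝[>] 0)
            (𝓝 (∑ m ∈ Finset.range (N + 1), (0 : ℝ) ^ m • a m)) := by
          refine Tendsto.mono_left (Continuous.tendsto ?_ 0) nhdsWithin_le_nhds
          fun_prop
        rw [hsum, zero_smul, zero_add] at h2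
        exact tendsto_nhds_unique h2 h1
      have h' : (fun s : ℝ => ∑ m ∈ Finset.range N, s ^ m • a (m + 1)) =O[𝓝[>] 0]
          fun s => s ^ M := by
        have hinv := (isBigO_refl (fun s : ℝ => s⁻¹) (𝓝[>] 0)).smul h
        refine (hinv.congr' ?_ ?_)
        · filter_upwards [self_mem_nhdsWithin] with s hs
          rw [hsum, h0, add_zero, smul_smul, inv_mul_cancel₀ (ne_of_gt hs), one_smul]
        · filter_upwards [self_mem_nhdsWithin] with s hs
          rw [smul_eq_mul, pow_succ', ← mul_assoc, inv_mul_cancel₀ (ne_of_gt hs), one_mul]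
      intro m hm hmM
      cases m with
      | zero => exact h0
      | succ m => exact ih h' m (by lia) (by lia)

theorem natCast_le_vOrder_iff_forall {E F : Type*} [NormedAddCommGroup E] [NormedSpace ℝ E]
    [NormedAddCommGroup F] [NormedSpace ℝ F] {f : E → F} {N : ℕ} :
    (N : ℝ≥0∞) ≤ vOrder f ↔ ∀ m < N, iteratedFDeriv ℝ m f 0 = 0 := by
  simp only [vOrder, Set.mem_ofPred_eq, le_iInf_iff, Nat.cast_le]
  refine forall_congr' fun m => ⟨fun h hm => ?_, fun h hm => ?_⟩
  · by_contra h'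
    exact absurd (h h') (by lia)
  · by_contra h'
    exact hm (h (by lia))

/-- A smooth function vanishes to order `N` at the origin in the sense of iterated derivatives if
and only if it is `O(‖x‖ ^ N)`. -/
theorem natCast_le_vOrder_iff {E F : Type} [NormedAddCommGroup E] [NormedSpace ℝ E]
    [NormedAddCommGroup F] [NormedSpace ℝ F] {f : E → F} (hf : ContDiffAt ℝ (⊤ : ℕ∞) f 0)
    {N : ℕ} : (N : ℝ≥0∞) ≤ vOrder f ↔ f =O[𝓝 0] fun x => ‖x‖ ^ N := by
  rw [natCast_le_vOrder_iff_forall]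
  have hT := isBigO_sub_taylor hf N
  simp only [zero_add] at hT
  refine ⟨fun h => ?_, fun h m hm => ?_⟩
  · refine hT.congr_left fun x => ?_
    rw [Finset.sum_eq_zero, sub_zero]
    intro m hm
    rw [h m (Finset.mem_range.1 hm)]
    simp
  · have hsum : (fun x => ∑ m ∈ Finset.range N,
        (m.factorial : ℝ)⁻¹ • iteratedFDeriv ℝ m f 0 fun _ => x) =O[𝓝 0] fun x => ‖x‖ ^ N := by
      refine (h.sub hT).congr_left fun x => by simp
    have hdiag : ∀ x : E, iteratedFDeriv ℝ m f 0 (fun _ => x) = 0 := by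
      intro x
      have hline : Tendsto (fun s : ℝ => s • x) (𝓝[>] 0) (𝓝 0) := by
        have : Tendsto (fun s : ℝ => s • x) (𝓝 0) (𝓝 ((0 : ℝ) • x)) :=
          Continuous.tendsto (by fun_prop) 0
        rw [zero_smul] at this
        exact this.mono_left nhdsWithin_le_nhds
      have h1 := hsum.comp_tendsto hline
      have h2 : (fun s : ℝ => ∑ m ∈ Finset.range N,
          s ^ m • ((m.factorial : ℝ)⁻¹ • iteratedFDeriv ℝ m f 0 fun _ => x)) =O[𝓝[>] 0]
          fun s => s ^ N := by
        refine (h1.congr_left fun s => ?_).trans ?_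
        · refine Finset.sum_congr rfl fun m _ => ?_
          have := (iteratedFDeriv ℝ m f 0).map_smul_univ (fun _ => s) fun _ => x
          rw [this, Finset.prod_const, Finset.card_univ, Fintype.card_fin, smul_comm]
        · refine IsBigO.of_bound (‖x‖ ^ N) (Eventually.of_forall fun s => ?_)
          simp [norm_smul, mul_pow, mul_comm]
      have h3 := eq_zero_of_sum_pow_smul_isBigO h2 m hm hm
      exact (smul_eq_zero.1 h3).resolve_left (by positivity)
    ext v
    have h4 := (iteratedFDeriv ℝ m f 0).iteratedFDeriv_comp_diagonal 0 v
    simp only [hdiag] at h4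
    have h5 : ∀ σ : Equiv.Perm (Fin m), iteratedFDeriv ℝ m f 0 (fun i => v (σ i)) =
        iteratedFDeriv ℝ m f 0 v := fun σ => iteratedFDeriv_comp_perm_of_contDiffAt hf σ v
    simp only [h5, Finset.sum_const, Finset.card_univ, Fintype.card_perm, Fintype.card_fin] at h4
    have h6 : iteratedFDeriv ℝ m (fun _ : E => (0 : F)) 0 v = 0 := by
      rw [iteratedFDeriv_fun_zero]
      rfl
    rw [h6, ← Nat.cast_smul_eq_nsmul ℝ] at h4
    exact (smul_eq_zero.1 h4.symm).resolve_left (by positivity)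

end VanishingOrder

section RealPolynomials

open Asymptotics Filter ComplexConjugate

theorem eq_zero_of_sum_mul_conj_isBigO {N M : ℕ} {Q : ℕ → ℕ → ℂ}
    (h : (fun t : ℂ => ∑ a ∈ Finset.range N, ∑ b ∈ Finset.range N, Q a b * (t ^ a * conj t ^ b))
      =O[𝓝 0] fun t => ‖t‖ ^ M) :
    ∀ a < N, ∀ b < N, a + b < M → Q a b = 0 := by
  intro a ha b hb hab
  set D : ℕ → Finset (ℕ × ℕ) := fun c =>
    (Finset.range N ×ˢ Finset.range N).filter fun x => x.1 + x.2 = c with hD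
  have hzero : ∀ u : ℂ, ‖u‖ = 1 → ∑ x ∈ D (a + b), Q x.1 x.2 * (u ^ x.1 * conj u ^ x.2) = 0 := by
    intro u hu
    have hline : Tendsto (fun s : ℝ => (s : ℂ) * u) (𝓝[>] 0) (𝓝 0) := by
      have : Tendsto (fun s : ℝ => (s : ℂ) * u) (𝓝 0) (𝓝 (((0 : ℝ) : ℂ) * u)) :=
        Continuous.tendsto (by fun_prop) 0
      rw [Complex.ofReal_zero, zero_mul] at this
      exact this.mono_left nhdsWithin_le_nhds
    have h1 : (fun s : ℝ => ∑ c ∈ Finset.range (2 * N),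
        s ^ c • ∑ x ∈ D c, Q x.1 x.2 * (u ^ x.1 * conj u ^ x.2)) =O[𝓝[>] 0] fun s => s ^ M := by
      refine ((h.comp_tendsto hline).congr_left fun s => ?_).trans ?_
      · simp only [Function.comp_apply]
        rw [← Finset.sum_product' (Finset.range N) (Finset.range N)
          (fun a b => Q a b * (((s : ℂ) * u) ^ a * conj ((s : ℂ) * u) ^ b)),
          ← Finset.sum_fiberwise_of_maps_to (t := Finset.range (2 * N)) (g := fun x => x.1 + x.2)]
        · refine Finset.sum_congr rfl fun c _ => ?_
          rw [Finset.smul_sum]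
          refine Finset.sum_congr rfl fun x hx => ?_
          rw [← (Finset.mem_filter.1 hx).2]
          simp only [map_mul, Complex.conj_ofReal, Complex.real_smul, Complex.ofReal_pow]
          ring
        · intro x hx
          simp only [Finset.mem_product, Finset.mem_range] at hx ⊢
          lia
      · refine IsBigO.of_bound 1 (Eventually.of_forall fun s => ?_)
        simp [hu]
    exact eq_zero_of_sum_pow_smul_isBigO h1 (a + b) (by lia) hab
  let P : Polynomial ℂ := ∑ x ∈ D (a + b), Polynomial.C (Q x.1 x.2) * Polynomial.X ^ x.1
  have hP : P = 0 := by
    refine Polynomial.eq_zero_of_infinite_isRoot P (Set.Infinite.mono (s := Metric.sphere 0 1) ?_ ?_)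
    · intro v hv
      rw [mem_sphere_zero_iff_norm] at hv
      obtain ⟨u, hu⟩ := IsAlgClosed.exists_pow_nat_eq v two_pos
      have hu1 : ‖u‖ = 1 := by
        rw [← hu, norm_pow] at hv
        exact (pow_eq_one_iff_of_nonneg (norm_nonneg u) two_ne_zero).1 hv
      have huu : u * conj u = 1 := by
        rw [Complex.mul_conj, Complex.normSq_eq_norm_sq, hu1]
        simp
      have := congrArg (fun y => u ^ (a + b) * y) (hzero u hu1)
      simp only [mul_zero, Finset.mul_sum] at this
      change P.eval v = 0
      rw [← this, Polynomial.eval_finsetSum]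
      refine Finset.sum_congr rfl fun x hx => ?_
      rw [← (Finset.mem_filter.1 hx).2, ← hu]
      simp only [Polynomial.eval_mul, Polynomial.eval_C, Polynomial.eval_pow, Polynomial.eval_X]
      calc _ = Q x.1 x.2 * (u ^ x.1 * u ^ x.1 * 1 ^ x.2) := by ring
        _ = _ := by rw [← huu]; ring
    · refine IsPreconnected.infinite_of_nontrivial
        (isPreconnected_sphere (by simp [Complex.rank_real_complex]) 0 1) ⟨1, by simp, -1, by simp, ?_⟩
      norm_num [Complex.ext_iff]
  have hc := congrArg (fun P => Polynomial.coeff P a) hP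
  simp only [P, Polynomial.finsetSum_coeff, Polynomial.coeff_C_mul, Polynomial.coeff_X_pow,
    Polynomial.coeff_zero] at hc
  rw [Finset.sum_eq_single (a, b)] at hc
  · simpa using hc
  · rintro ⟨a', b'⟩ hx hne
    rw [if_neg, mul_zero]
    rintro rfl
    have := (Finset.mem_filter.1 hx).2
    exact hne (by simp at this ⊢; lia)
  · intro hx
    exact absurd (by simp [hD, ha, hb]) hx

theorem sum_mul_conj_isBigO {N M : ℕ} {Q : ℕ → ℕ → ℂ}
    (h : ∀ a < N, ∀ b < N, a + b < M → Q a b = 0) :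
    (fun t : ℂ => ∑ a ∈ Finset.range N, ∑ b ∈ Finset.range N, Q a b * (t ^ a * conj t ^ b))
      =O[𝓝 0] fun t => ‖t‖ ^ M := by
  refine IsBigO.fun_sum fun a ha => IsBigO.fun_sum fun b hb => ?_
  rw [Finset.mem_range] at ha hb
  rcases lt_or_ge (a + b) M with hlt | hge
  · simpa [h a ha b hb hlt] using isBigO_zero (fun t : ℂ => ‖t‖ ^ M) (𝓝 0)
  · refine IsBigO.const_mul_left ?_ _
    refine IsBigO.of_bound 1 ?_
    filter_upwards [Metric.ball_mem_nhds (0 : ℂ) one_pos] with t ht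
    rw [mem_ball_zero_iff] at ht
    simp only [norm_mul, norm_pow, RCLike.norm_conj, norm_norm, one_mul, ← pow_add]
    exact pow_le_pow_of_le_one (norm_nonneg _) ht.le hge

end RealPolynomials

section TaylorForm

open Asymptotics Filter ComplexConjugate

theorem exists_taylor_form {n : ℕ} {U : Set (Fin n → ℂ)} (hU : IsOpen U) {r : (Fin n → ℂ) → ℝ}
    (hr : ContDiffOn ℝ (⊤ : ℕ∞) r U) (K : ℕ) :
    ∃ (J : Type) (_ : Fintype J) (c : J → (Fin n → ℂ) → ℂ) (A B : J → (Fin n →₀ ℕ)),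
      (∀ j, ∀ q ∈ U, ContinuousAt (c j) q) ∧ ∀ q ∈ U,
      (fun h : Fin n → ℂ => (r (q + h) : ℂ) -
        ∑ j, c j q * ((∏ i, h i ^ A j i) * ∏ i, conj (h i) ^ B j i)) =O[𝓝 0] fun h => ‖h‖ ^ K := by
  classical
  let e : Fin n ⊕ Fin n → (Fin n → ℂ) :=
    Sum.elim (fun i => Pi.single i 1) (fun i => Pi.single i Complex.I)
  let y : Fin n ⊕ Fin n → (Fin n → ℂ) → ℝ := Sum.elim (fun i h => (h i).re) (fun i h => (h i).im)
  let w : Fin n ⊕ Fin n → (Fin n → ℂ) → ℂ := Sum.elim (fun i h => h i) (fun i h => conj (h i))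
  have hy : ∀ h, h = ∑ x, y x h • e x := by
    intro h
    rw [Fintype.sum_sum_type, ← Finset.sum_add_distrib]
    funext i
    rw [Finset.sum_apply, Finset.sum_eq_single i]
    · simp [y, e, Complex.re_add_im]
    · intro j _ hj
      simp [y, e, hj.symm]
    · simp
  obtain ⟨κ, hκ⟩ : ∃ κ : Fin n ⊕ Fin n → Fin n ⊕ Fin n → ℂ,
      ∀ x h, (y x h : ℂ) = ∑ x', κ x x' * w x' h := by
    refine ⟨Sum.elim
      (fun i => Sum.elim (fun j => if i = j then 1 / 2 else 0) (fun j => if i = j then 1 / 2 else 0))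
      (fun i => Sum.elim (fun j => if i = j then -Complex.I / 2 else 0)
        (fun j => if i = j then Complex.I / 2 else 0)), ?_⟩
    rintro (i | i) h
    · simp [y, w, Complex.re_eq_add_conj]
      ring
    · simp [y, w, Complex.im_eq_sub_conj]
      field_simp
      ring_nf
      simp
      ring
  have hprod : ∀ (m : ℕ) (f : Fin m → Fin n ⊕ Fin n) (h : Fin n → ℂ), ∏ l, w (f l) h =
      (∏ i, h i ^ (Finset.univ.filter fun l => f l = Sum.inl i).card) *
        ∏ i, conj (h i) ^ (Finset.univ.filter fun l => f l = Sum.inr i).card := by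
    intro m f h
    rw [← Finset.prod_fiberwise' Finset.univ f (fun x => w x h), Fintype.prod_sum_type]
    simp [w]
  refine ⟨Σ m : Fin K, (Fin m → Fin n ⊕ Fin n), inferInstance,
    fun j q => ((j.1 : ℕ).factorial : ℂ)⁻¹ * ∑ s : Fin j.1 → Fin n ⊕ Fin n,
      (iteratedFDeriv ℝ j.1 r q (fun l => e (s l)) : ℂ) * ∏ l, κ (s l) (j.2 l),
    fun j => Finsupp.equivFunOnFinite.symm fun i =>
      (Finset.univ.filter fun l => j.2 l = Sum.inl i).card,
    fun j => Finsupp.equivFunOnFinite.symm fun i =>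
      (Finset.univ.filter fun l => j.2 l = Sum.inr i).card, fun j q hq => ?_, fun q hq => ?_⟩
  · refine continuousAt_const.mul (tendsto_finsetSum _ fun s _ => ContinuousAt.mul_const ?_ _)
    refine Complex.continuous_ofReal.continuousAt.comp ?_
    have hc : ContinuousAt (iteratedFDeriv ℝ (j.1 : ℕ) r) q :=
      (hr.contDiffAt (hU.mem_nhds hq)).continuousAt_iteratedFDeriv (by exact_mod_cast le_top)
    exact (ContinuousMultilinearMap.apply ℝ (fun _ : Fin j.1 => Fin n → ℂ) ℝ
      fun l => e (s l)).continuous.continuousAt.comp hc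
  · have hT := isBigO_sub_taylor (hr.contDiffAt (hU.mem_nhds hq)) K
    refine (IsBigO.of_norm_left (hT.norm_left.congr_left fun h => ?_))
    rw [← Complex.norm_real, Complex.ofReal_sub, Fintype.sum_sigma, Complex.ofReal_sum,
      ← Fin.sum_univ_eq_sum_range
        (fun m => (((m.factorial : ℝ)⁻¹ • iteratedFDeriv ℝ m r q fun _ => h : ℝ) : ℂ))]
    congr 2
    refine Finset.sum_congr rfl fun m _ => ?_
    have h1 : (iteratedFDeriv ℝ m r q fun _ => h) = ∑ s : Fin m → Fin n ⊕ Fin n,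
        (∏ l, y (s l) h) * iteratedFDeriv ℝ m r q fun l => e (s l) := by
      conv_lhs => rw [hy h]
      have := (iteratedFDeriv ℝ m r q).toMultilinearMap.map_sum (fun _ x => y x h • e x)
      refine this.trans (Finset.sum_congr rfl fun s _ => ?_)
      exact (iteratedFDeriv ℝ m r q).map_smul_univ (fun l => y (s l) h) fun l => e (s l)
    have h2 : ∀ s : Fin m → Fin n ⊕ Fin n, ((∏ l, y (s l) h : ℝ) : ℂ) =
        ∑ f : Fin m → Fin n ⊕ Fin n, (∏ l, κ (s l) (f l)) * ∏ l, w (f l) h := by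
      intro s
      rw [Complex.ofReal_prod]
      simp_rw [hκ, Finset.prod_univ_sum, Fintype.piFinset_univ, Finset.prod_mul_distrib]
    simp only [smul_eq_mul, Complex.ofReal_mul, h1, Complex.ofReal_sum, h2,
      Finsupp.equivFunOnFinite_symm_apply_apply, ← hprod, Complex.ofReal_inv,
      Complex.ofReal_natCast, mul_assoc, Finset.sum_mul, ← Finset.mul_sum]
    congr 1
    rw [Finset.sum_comm]
    exact Finset.sum_congr rfl fun s _ => Finset.sum_congr rfl fun f _ => by ring

end TaylorForm

section Isotropy

open Asymptotics Filter ComplexConjugate Polynomial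

variable {n : ℕ} {J : Type} [Fintype J]

/-- The sesquilinear pairing with matrix `c`, the index `j` sitting in position `(A j, B j)`. -/
noncomputable def pairForm (c : J → ℂ) (A B : J → (Fin n →₀ ℕ)) (x y : (Fin n →₀ ℕ) →₀ ℂ) : ℂ :=
  ∑ j, c j * (x (A j) * conj (y (B j)))

theorem pairForm_eq_zero_of_mem_curveSpace {c : J → ℂ} {A B : J → (Fin n →₀ ℕ)}
    {f : Fin n → ℂ[X]} {N : ℕ}
    (h : ∀ a < N, ∀ b < N, pairForm c A B (curveVec f a) (curveVec f b) = 0)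
    {x y : (Fin n →₀ ℕ) →₀ ℂ} (hx : x ∈ curveSpace f N) (hy : y ∈ curveSpace f N) :
    pairForm c A B x y = 0 := by
  induction hx using Submodule.span_induction with
  | mem x hx =>
    obtain ⟨a, ha, rfl⟩ := hx
    induction hy using Submodule.span_induction with
    | mem y hy =>
      obtain ⟨b, hb, rfl⟩ := hy
      exact h a ha b hb
    | zero => simp [pairForm]
    | add y z _ _ hy hz =>
      simp only [pairForm, Finsupp.add_apply, map_add, mul_add, Finset.sum_add_distrib] at hy hz ⊢
      rw [hy, hz, add_zero]
    | smul s y _ hy =>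
      have : pairForm c A B (curveVec f a) (s • y) =
          conj s * pairForm c A B (curveVec f a) y := by
        simp only [pairForm, Finsupp.smul_apply, smul_eq_mul, map_mul, Finset.mul_sum]
        exact Finset.sum_congr rfl fun j _ => by ring
      rw [this, hy, mul_zero]
  | zero => simp [pairForm]
  | add x z _ _ hx hz =>
    simp only [pairForm, Finsupp.add_apply, add_mul, mul_add, Finset.sum_add_distrib] at hx hz ⊢
    rw [hx, hz, add_zero]
  | smul s x _ hx =>
    have : pairForm c A B (s • x) y = s * pairForm c A B x y := by
      simp only [pairForm, Finsupp.smul_apply, smul_eq_mul, Finset.mul_sum]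
      exact Finset.sum_congr rfl fun j _ => by ring
    rw [this, hx, mul_zero]

theorem sum_monomials_curve_eq (c : J → ℂ) (A B : J → (Fin n →₀ ℕ)) {f : Fin n → ℂ[X]}
    (hf : ∀ i, X ∣ f i) : ∃ N₀, ∀ N ≥ N₀, ∀ t : ℂ,
      ∑ j, c j * ((∏ i, (f i).eval t ^ A j i) * ∏ i, conj ((f i).eval t) ^ B j i) =
      ∑ a ∈ Finset.range N, ∑ b ∈ Finset.range N,
        pairForm c A B (curveVec f a) (curveVec f b) * (t ^ a * conj t ^ b) := by
  refine ⟨(Finset.univ.sup fun j => (curveMonomial f (A j)).natDegree) +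
    (Finset.univ.sup fun j => (curveMonomial f (B j)).natDegree) + 1, fun N hN t => ?_⟩
  have hA : ∀ j, (curveMonomial f (A j)).natDegree < N := fun j => by
    have := Finset.le_sup (f := fun j => (curveMonomial f (A j)).natDegree) (Finset.mem_univ j)
    lia
  have hB : ∀ j, (curveMonomial f (B j)).natDegree < N := fun j => by
    have := Finset.le_sup (f := fun j => (curveMonomial f (B j)).natDegree) (Finset.mem_univ j)
    lia
  have hmon : ∀ α, ∏ i, (f i).eval t ^ α i = (curveMonomial f α).eval t := fun α => by
    simp [curveMonomial, eval_prod]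
  simp only [← map_pow, ← map_prod, hmon]
  simp only [eval_eq_sum_range' (hA _), eval_eq_sum_range' (hB _), pairForm, curveVec_apply hf,
    map_sum, map_mul, map_pow, Finset.sum_mul, Finset.mul_sum]
  rw [Finset.sum_congr rfl fun j _ => Finset.sum_comm, Finset.sum_comm]
  refine Finset.sum_congr rfl fun a _ => ?_
  rw [Finset.sum_comm]
  exact Finset.sum_congr rfl fun b _ => Finset.sum_congr rfl fun j _ => by ring

theorem eval_curve_isBigO {ν : ℕ} {f : Fin n → ℂ[X]} (hf : ∀ i, X ^ ν ∣ f i) :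
    (fun (t : ℂ) i => (f i).eval t) =O[𝓝 0] fun t => ‖t‖ ^ ν := by
  rw [isBigO_pi]
  intro i
  obtain ⟨q, hq⟩ := hf i
  simp only [hq, eval_mul, eval_pow, eval_X]
  have h1 : (fun t : ℂ => t ^ ν) =O[𝓝 0] fun t => ‖t‖ ^ ν :=
    IsBigO.of_bound 1 (Eventually.of_forall fun t => by simp)
  have h2 : (fun t : ℂ => q.eval t) =O[𝓝 0] fun _ => (1 : ℝ) :=
    (q.continuous.tendsto 0).isBigO_one ℝ
  simpa using h1.mul h2

theorem tendsto_eval_curve {f : Fin n → ℂ[X]} (hf : ∀ i, X ∣ f i) :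
    Tendsto (fun (t : ℂ) i => (f i).eval t) (𝓝 0) (𝓝 0) := by
  refine tendsto_pi_nhds.2 fun i => ?_
  have := (f i).continuous.tendsto 0
  rwa [← coeff_zero_eq_eval_zero, X_dvd_iff.1 (hf i)] at this

theorem isBigO_curve_iff {r : (Fin n → ℂ) → ℝ} {q : Fin n → ℂ} {K : ℕ} {c : J → ℂ}
    {A B : J → (Fin n →₀ ℕ)} (hT : (fun h : Fin n → ℂ => (r (q + h) : ℂ) -
      ∑ j, c j * ((∏ i, h i ^ A j i) * ∏ i, conj (h i) ^ B j i)) =O[𝓝 0] fun h => ‖h‖ ^ K)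
    {ν : ℕ} (hν : ν ≠ 0) {f : Fin n → ℂ[X]} (hf : ∀ i, X ^ ν ∣ f i) {M : ℕ} (hM : M ≤ K * ν) :
    (fun t : ℂ => r (q + fun i => (f i).eval t)) =O[𝓝 0] (fun t => ‖t‖ ^ M) ↔
      ∀ a b, a + b < M → pairForm c A B (curveVec f a) (curveVec f b) = 0 := by
  have hf1 : ∀ i, X ∣ f i := fun i => (dvd_pow_self X hν).trans (hf i)
  obtain ⟨N₀, hN₀⟩ := sum_monomials_curve_eq c A B hf1
  have hpow : (fun t : ℂ => ‖t‖ ^ (ν * K)) =O[𝓝 0] fun t => ‖t‖ ^ M := by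
    refine IsBigO.of_bound 1 ?_
    filter_upwards [Metric.ball_mem_nhds (0 : ℂ) one_pos] with t ht
    rw [mem_ball_zero_iff] at ht
    simp only [norm_pow, norm_norm, one_mul]
    exact pow_le_pow_of_le_one (norm_nonneg _) ht.le (by rwa [mul_comm])
  have hT' := ((hT.comp_tendsto (tendsto_eval_curve hf1)).trans (((eval_curve_isBigO hf).norm_left.pow
    K).congr_right fun t => by rw [← pow_mul])).trans hpow
  have key : ∀ N ≥ N₀, ((fun t : ℂ => r (q + fun i => (f i).eval t)) =O[𝓝 0] (fun t => ‖t‖ ^ M) ↔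
      (fun t : ℂ => ∑ a ∈ Finset.range N, ∑ b ∈ Finset.range N,
        pairForm c A B (curveVec f a) (curveVec f b) * (t ^ a * conj t ^ b)) =O[𝓝 0]
        fun t => ‖t‖ ^ M) := by
    intro N hN
    have hcast : (fun t : ℂ => r (q + fun i => (f i).eval t)) =O[𝓝 0] (fun t => ‖t‖ ^ M) ↔
        (fun t : ℂ => (r (q + fun i => (f i).eval t) : ℂ)) =O[𝓝 0] (fun t => ‖t‖ ^ M) := by
      rw [← isBigO_norm_left, ← isBigO_norm_left (f' := fun t : ℂ => (r _ : ℂ))]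
      simp only [Complex.norm_real]
    rw [hcast]
    simp only [← hN₀ N hN]
    refine ⟨fun h => (h.sub hT').congr_left fun t => ?_, fun h => (hT'.add h).congr_left fun t => ?_⟩
    · simp
    · simp
  constructor
  · intro h a b hab
    exact eq_zero_of_sum_mul_conj_isBigO ((key (N₀ + a + b + 1) (by lia)).1 h) a (by lia) b
      (by lia) hab
  · intro h
    exact (key N₀ le_rfl).2 (sum_mul_conj_isBigO fun a _ b _ hab => h a b hab)

/-- Curves with increasingly high order of contact with `M` at points converging to `p` produce
curves of bounded multiplicity with arbitrarily high order of contact with `M` at `p`. -/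
theorem exists_curves_of_sequence {M : Set (Fin n → ℂ)} {p : Fin n → ℂ} {q : ℕ → Fin n → ℂ}
    (hq : Tendsto q atTop (𝓝 p)) {ν : ℕ → ℕ} (hν : ∀ j, ν j ≠ 0) {g : ℕ → Fin n → ℂ[X]}
    (hg : ∀ j i, X ^ ν j ∣ g j i) (hgν : ∀ j, ∃ i, (g j i).coeff (ν j) ≠ 0)
    (hr : ∀ j, ∀ r ∈ IMp n M (q j),
      (fun t : ℂ => r (q j + fun i => (g j i).eval t)) =O[𝓝 0] fun t => ‖t‖ ^ (j * ν j)) :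
    ∃ a, ∀ T, ∃ f : Fin n → ℂ[X], (∀ i, X ∣ f i) ∧ (∃ i, ∃ b ≤ a, (f i).coeff b ≠ 0) ∧
      ∀ r ∈ IMp n M p,
        (fun t : ℂ => r (p + fun i => (f i).eval t)) =O[𝓝 0] fun t => ‖t‖ ^ T := by
  have h𝒰 : (hyperfilter ℕ : Filter ℕ) ≤ atTop := by
    rw [← Nat.cofinite_eq_atTop]
    exact hyperfilter_le_cofinite
  obtain ⟨a, ha⟩ := exists_curve_of_limit (hyperfilter ℕ) g ν hν hg hgν
  refine ⟨a, fun T => ?_⟩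
  obtain ⟨f, hf, hfb, k₀, hk₀⟩ := ha T
  refine ⟨f, hf, hfb, ?_⟩
  rintro r ⟨U, hU, hpU, hrU, hrM⟩
  set k := max k₀ T with hk
  obtain ⟨J, _, c, A, B, hc, hT⟩ := exists_taylor_form hU hrU (2 * k)
  rw [isBigO_curve_iff (hT p hpU) one_ne_zero (by simpa using hf) (by lia)]
  intro s s' hs
  obtain ⟨x, hx, hxl⟩ := mem_limitSubmodule.1 (hk₀ k (le_max_left _ _) s (by lia))
  obtain ⟨y, hy, hyl⟩ := mem_limitSubmodule.1 (hk₀ k (le_max_left _ _) s' (by lia))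
  have hlim : Tendsto (fun j => pairForm (fun i => c i (q j)) A B (x j) (y j)) (hyperfilter ℕ)
      (𝓝 (pairForm (fun i => c i p) A B (curveVec f s) (curveVec f s'))) := by
    refine tendsto_finsetSum _ fun i _ => ((hc i p hpU).tendsto.comp (hq.mono_left h𝒰)).mul
      ((hxl _).mul ?_)
    exact (Complex.continuous_conj.tendsto _).comp (hyl _)
  refine tendsto_nhds_unique hlim (Tendsto.congr' ?_ tendsto_const_nhds)
  have hev : ∀ᶠ j in atTop, q j ∈ U ∧ 2 * k ≤ j :=
    (hq.eventually (hU.mem_nhds hpU)).and (eventually_ge_atTop _)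
  filter_upwards [h𝒰 hev] with j hj
  refine (pairForm_eq_zero_of_mem_curveSpace (fun b hb b' hb' => ?_) (hx j) (hy j)).symm
  have hO := hr j r ⟨U, hU, hj.1, hrU, hrM⟩
  have hO' : (fun t : ℂ => r (q j + fun i => (g j i).eval t)) =O[𝓝 0]
      fun t => ‖t‖ ^ (2 * k * ν j) := by
    refine hO.trans (IsBigO.of_bound 1 ?_)
    filter_upwards [Metric.ball_mem_nhds (0 : ℂ) one_pos] with t ht
    rw [mem_ball_zero_iff] at ht
    simp only [norm_pow, norm_norm, one_mul]
    exact pow_le_pow_of_le_one (norm_nonneg _) ht.le (Nat.mul_le_mul_right _ hj.2)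
  exact (isBigO_curve_iff (hT (q j) hj.1) (hν j) (hg j) le_rfl).1 hO' b b' (by nlinarith)

end Isotropy

section FiniteType

open Asymptotics Filter Polynomial

theorem AnalyticAt.exists_coeff {f : ℂ → ℂ} (hf : AnalyticAt ℂ f 0) :
    ∃ c : ℕ → ℂ, (∀ N, (fun t => f t - ∑ m ∈ Finset.range N, t ^ m * c m) =O[𝓝 0]
      fun t => ‖t‖ ^ N) ∧ ((∀ m, c m = 0) → ∀ᶠ t in 𝓝 0, f t = 0) ∧ c 0 = f 0 := by
  obtain ⟨P, hP⟩ := hf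
  refine ⟨P.coeff, fun N => ?_, fun h => ?_, ?_⟩
  · refine (hP.isBigO_sub_partialSum_pow N).congr_left fun t => ?_
    simp [FormalMultilinearSeries.partialSum]
  · have : P = 0 := by
      ext m : 1
      exact FormalMultilinearSeries.coeff_eq_zero.1 (h m)
    rw [this] at hP
    exact hP.eventually_eq_zero
  · exact hP.coeff_zero _

theorem Polynomial.coeff_eq_zero_of_isBigO {f : ℂ[X]} {N : ℕ}
    (h : (fun t : ℂ => f.eval t) =O[𝓝 0] fun t => ‖t‖ ^ N) {b : ℕ} (hb : b < N) :
    f.coeff b = 0 := by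
  have ht : Tendsto (fun s : ℝ => (s : ℂ)) (𝓝[>] 0) (𝓝 0) :=
    (Complex.continuous_ofReal.tendsto' 0 0 rfl).mono_left nhdsWithin_le_nhds
  refine eq_zero_of_sum_pow_smul_isBigO (N := f.natDegree + b + 1) (M := N) (a := f.coeff) ?_ b
    (by lia) hb
  refine ((h.comp_tendsto ht).congr_left fun s => ?_).trans
    (IsBigO.of_bound 1 (Eventually.of_forall fun s => by simp))
  simp only [Function.comp]
  rw [eval_eq_sum_range' (n := f.natDegree + b + 1) (by lia)]
  refine Finset.sum_congr rfl fun m _ => ?_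
  rw [← Complex.ofReal_pow, Complex.real_smul, mul_comm]

variable {n : ℕ} {M : Set (Fin n → ℂ)} {p : Fin n → ℂ}

theorem contDiffAt_of_mem_IMp {r : (Fin n → ℂ) → ℝ} (hr : r ∈ IMp n M p) :
    ContDiffAt ℝ (⊤ : ℕ∞) r p := by
  obtain ⟨U, hU, hpU, hrU, -⟩ := hr
  exact hrU.contDiffAt (hU.mem_nhds hpU)

theorem eq_zero_of_mem_IMp (hp : p ∈ M) {r : (Fin n → ℂ) → ℝ} (hr : r ∈ IMp n M p) :
    r p = 0 := by
  obtain ⟨U, -, hpU, -, hrM⟩ := hr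
  exact hrM p ⟨hp, hpU⟩

theorem AnalyticAt.natCast_le_vOrder_sub_iff {F : Type} [NormedAddCommGroup F] [NormedSpace ℂ F]
    [CompleteSpace F] {f : ℂ → F}
    (hf : AnalyticAt ℂ f 0) (v : F) {N : ℕ} :
    (N : ℝ≥0∞) ≤ vOrder (fun t => f t - v) ↔ (fun t => f t - v) =O[𝓝 0] fun t => ‖t‖ ^ N :=
  natCast_le_vOrder_iff ((hf.contDiffAt.restrict_scalars ℝ).sub contDiffAt_const)

theorem natCast_le_vOrder_comp_iff {γ : ℂ → Fin n → ℂ} (hγ : AnalyticAt ℂ γ 0) (hγp : γ 0 = p)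
    (hp : p ∈ M) {r : (Fin n → ℂ) → ℝ} (hr : r ∈ IMp n M p) {N : ℕ} :
    (N : ℝ≥0∞) ≤ vOrder (fun t => r (γ t) - r p) ↔
      (fun t => r (γ t)) =O[𝓝 0] fun t => ‖t‖ ^ N := by
  have : ContDiffAt ℝ (⊤ : ℕ∞) (fun t => r (γ t)) 0 :=
    ContDiffAt.comp (0 : ℂ) (hγp ▸ contDiffAt_of_mem_IMp hr) (hγ.contDiffAt.restrict_scalars ℝ)
  simp only [eq_zero_of_mem_IMp hp hr, sub_zero]
  exact natCast_le_vOrder_iff this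

/-- At a point of infinite type there are polynomial curves with arbitrarily high order of contact
relative to their multiplicity. -/
theorem exists_polynomial_curve_of_Delta_eq_top (hp : p ∈ M) (hΔ : Delta n M p = ⊤) (L : ℕ) :
    ∃ ν ≠ 0, ∃ g : Fin n → ℂ[X], (∀ i, X ^ ν ∣ g i) ∧ (∃ i, (g i).coeff ν ≠ 0) ∧
      ∀ r ∈ IMp n M p,
        (fun t : ℂ => r (p + fun i => (g i).eval t)) =O[𝓝 0] fun t => ‖t‖ ^ (L * ν) := by
  classical
  have hL : (L : ℝ≥0∞) < Delta n M p := hΔ ▸ ENNReal.natCast_lt_top L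
  obtain ⟨γ, hγL⟩ := lt_iSup_iff.1 hL
  obtain ⟨⟨hγ, hγp, hγc⟩, hγL⟩ := lt_iSup_iff.1 hγL
  have hγi : ∀ i, AnalyticAt ℂ (fun t => γ t i) 0 := fun i => analyticAt_pi_iff.1 hγ i
  choose c hc hc0 hcz using fun i => ((hγi i).sub (analyticAt_const (v := p i))).exists_coeff
  have hex : ∃ m, ∃ i, c i m ≠ 0 := by
    by_contra! h
    refine hγc ?_
    filter_upwards [eventually_all.2 fun i => hc0 i fun m => h m i] with t ht
    ext i
    exact sub_eq_zero.1 (ht i)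
  set ν := Nat.find hex with hνdef
  have hmin : ∀ m < ν, ∀ i, c i m = 0 := fun m hm i => by
    by_contra h
    exact Nat.find_min hex hm ⟨i, h⟩
  have hν : ν ≠ 0 := by
    intro h0
    obtain ⟨i, hi⟩ := Nat.find_spec hex
    rw [← hνdef, h0, hcz] at hi
    simp [hγp] at hi
  set N := L * ν + ν + 1 with hN
  have hnu : (ν : ℝ≥0∞) ≤ nuCurve γ p := by
    refine le_iInf fun i => ((hγi i).natCast_le_vOrder_sub_iff (p i)).2 ?_
    refine (hc i ν).congr_left fun t => ?_
    rw [Finset.sum_eq_zero fun m hm => by rw [hmin m (Finset.mem_range.1 hm), mul_zero]]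
    simp
  set g : Fin n → ℂ[X] := fun i => ∑ m ∈ Finset.range N, C (c i m) * X ^ m with hg
  have hcoeff : ∀ i m, m < N → (g i).coeff m = c i m := fun i m hm => by
    simp [hg, finsetSum_coeff, coeff_C_mul, coeff_X_pow, hm]
  refine ⟨ν, hν, g, fun i => ?_, ?_, fun r hr => ?_⟩
  · refine X_pow_dvd_iff.2 fun m hm => ?_
    rw [hcoeff i m (by lia), hmin m hm]
  · obtain ⟨i, hi⟩ := Nat.find_spec hex
    exact ⟨i, by rwa [hcoeff i _ (by lia)]⟩
  · have hgX : ∀ i, X ∣ g i := fun i => X_dvd_iff.2 <| by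
      rw [hcoeff i 0 (by lia), hmin 0 (by lia)]
    have h1 : ((L * ν : ℕ) : ℝ≥0∞) ≤ vOrder (fun t => r (γ t) - r p) := by
      have := (hγL.trans_le (iInf₂_le r hr)).le
      have := ENNReal.mul_le_of_le_div this
      push_cast
      exact (mul_le_mul_right hnu _).trans this
    have h2 := (natCast_le_vOrder_comp_iff hγ hγp hp hr).1 h1
    have hdiff : (fun t : ℂ => (p + fun i => (g i).eval t) - γ t) =O[𝓝 0]
        fun t => ‖t‖ ^ (L * ν) := by
      refine isBigO_pi.2 fun i => ?_
      have hpow : (fun t : ℂ => ‖t‖ ^ N) =O[𝓝 0] fun t => ‖t‖ ^ (L * ν) := by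
        refine IsBigO.of_bound 1 ?_
        filter_upwards [Metric.ball_mem_nhds (0 : ℂ) one_pos] with t ht
        rw [mem_ball_zero_iff] at ht
        simp only [norm_pow, norm_norm, one_mul]
        exact pow_le_pow_of_le_one (norm_nonneg _) ht.le (by lia)
      refine ((hc i N).neg_left.trans hpow).congr_left fun t => ?_
      simp only [hg, eval_finsetSum, eval_mul, eval_C, eval_pow, eval_X, Pi.sub_apply, Pi.add_apply,
        mul_comm (c i _)]
      ring
    obtain ⟨K, s, hs, hK⟩ := ((contDiffAt_of_mem_IMp hr).of_le (m := 1) (by simp)).exists_lipschitzOnWith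
    have hγs : ∀ᶠ t in 𝓝 (0 : ℂ), γ t ∈ s :=
      hγ.continuousAt.eventually (hγp.symm ▸ hs)
    have hgs : ∀ᶠ t in 𝓝 (0 : ℂ), (p + fun i => (g i).eval t) ∈ s := by
      have := (tendsto_eval_curve hgX).const_add p
      rw [add_zero] at this
      exact this.eventually hs
    have h3 : (fun t : ℂ => r (p + fun i => (g i).eval t) - r (γ t)) =O[𝓝 0]
        fun t => ‖t‖ ^ (L * ν) := by
      refine IsBigO.trans (IsBigO.of_bound K ?_) hdiff
      filter_upwards [hγs, hgs] with t h1 h2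
      exact hK.norm_sub_le h2 h1
    exact (h3.add h2).congr_left fun t => by ring

/-- At a point of finite type the order of contact of polynomial curves is controlled by their
multiplicity. -/
theorem exists_forall_not_isBigO_of_Delta_lt_top (hp : p ∈ M) (hΔ : Delta n M p < ⊤) :
    ∃ D : ℕ, ∀ g : Fin n → ℂ[X], (∀ i, X ∣ g i) → ∀ b, (∃ i, (g i).coeff b ≠ 0) →
      ¬ ∀ r ∈ IMp n M p,
        (fun t : ℂ => r (p + fun i => (g i).eval t)) =O[𝓝 0] fun t => ‖t‖ ^ (D * b) := by
  obtain ⟨D, hD⟩ := ENNReal.exists_nat_gt hΔ.ne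
  refine ⟨D, fun g hg b ⟨i, hi⟩ h => hD.not_ge ?_⟩
  have hb : b ≠ 0 := by
    rintro rfl
    exact hi (X_dvd_iff.1 (hg i))
  set γ : ℂ → Fin n → ℂ := fun t => p + fun i => (g i).eval t with hγdef
  have hγ : AnalyticAt ℂ γ 0 := by
    refine analyticAt_pi_iff.2 fun i => ?_
    exact analyticAt_const.add ((AnalyticOnNhd.eval_polynomial (g i)) 0 trivial)
  have hγp : γ 0 = p := by
    ext i
    simp [hγdef, ← coeff_zero_eq_eval_zero, X_dvd_iff.1 (hg i)]
  have hγi : AnalyticAt ℂ (fun t => γ t i) 0 := analyticAt_pi_iff.1 hγ i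
  have hγc : ¬ ∀ᶠ t in 𝓝 (0 : ℂ), γ t = p := fun hc => hi <|
    coeff_eq_zero_of_isBigO (N := b + 1)
      (IsBigO.of_bound 0 (hc.mono fun t ht => by
        have := congrFun ht i
        simp only [hγdef, Pi.add_apply, add_eq_left] at this
        simp [this])) (by lia)
  have hnu : nuCurve γ p ≤ b := by
    by_contra! hlt
    refine hi (coeff_eq_zero_of_isBigO (N := b + 1) ?_ (by lia))
    have h1 : ((b + 1 : ℕ) : ℝ≥0∞) ≤ vOrder (fun t => γ t i - p i) := by
      refine le_iInf₂ fun m hm => ?_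
      have h2 : (b : ℝ≥0∞) < m := (hlt.trans_le (iInf_le _ i)).trans_le (iInf₂_le m hm)
      exact_mod_cast h2
    refine ((hγi.natCast_le_vOrder_sub_iff (p i)).1 h1).congr_left fun t => ?_
    simp [hγdef]
  refine le_iSup₂_of_le γ ⟨hγ, hγp, hγc⟩ (le_iInf₂ fun r hr => ?_)
  have h1 := (natCast_le_vOrder_comp_iff hγ hγp hp hr).2 (h r hr)
  calc (D : ℝ≥0∞) = ((D * b : ℕ) : ℝ≥0∞) / b := by
        push_cast
        rw [ENNReal.mul_div_cancel_right (by exact_mod_cast hb) (ENNReal.natCast_ne_top b)]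
    _ ≤ _ := ENNReal.div_le_div h1 hnu

end FiniteType

/-- For any subset `M ⊆ ℂⁿ`, the set of points of `M` of finite type is an open subset
of `M` in the subspace topology. -/
theorem isOpen_finiteType (n : ℕ) (M : Set (Fin n → ℂ)) :
    IsOpen {p : M | Delta n M p.1 < ⊤} := by
  rw [← isClosed_compl_iff, ← isSeqClosed_iff_isClosed]
  intro q p hq hqp hp
  obtain ⟨D, hD⟩ := exists_forall_not_isBigO_of_Delta_lt_top p.2 hp
  choose ν hν g hg hgν hr using fun j =>
    exists_polynomial_curve_of_Delta_eq_top (q j).2 (not_lt_top_iff.1 (hq j)) j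
  obtain ⟨a, ha⟩ := exists_curves_of_sequence
    ((continuous_subtype_val.tendsto p).comp hqp) hν hg hgν hr
  obtain ⟨f, hf, ⟨i, b, hb, hfb⟩, hfr⟩ := ha (D * a)
  refine hD f hf b ⟨i, hfb⟩ fun r hr => (hfr r hr).trans (Asymptotics.IsBigO.of_bound 1 ?_)
  filter_upwards [Metric.ball_mem_nhds (0 : ℂ) one_pos] with t ht
  rw [mem_ball_zero_iff] at ht
  simp only [norm_pow, norm_norm, one_mul]
  exact pow_le_pow_of_le_one (norm_nonneg _) ht.le (Nat.mul_le_mul_left _ hb)
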